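/- arXiv:1704.07997 — 6 statements merged into one kernel-verified Lean document; each statement's English description precedes it below -/
import Mathlib

section
/- Let n ≥ 1 and let {z_i} = {(x_i, t_i)} be a countable family of points in ℝ^{n+1}_+ = ℝⁿ × (0,∞), and let δ_{z_i} denote the Dirac mass at z_i. Assume that the measure Σ_i t_i^n δ_{z_i} is a Carleson measure with ||| Σ_i t_i^n δ_{z_i} |||_c ≤ 1. Let Φ_t(x,y) = t/(t + |x−y|)^{n+1}, and define the measure μ on ℝ^{n+1}_+ by μ(E) = Σ_i t_i^n ∫_{ℝⁿ} 1_E(y, t_i) Φ_{t_i}(y, x_i) dy (that is, μ = Σ_i t_i^n Φ_{t_i}(·, x_i) ds_i, where ds_i is n-dimensional Lebesgue measure on the hyperplane {t = t_i}). Then μ is a Carleson measure with |||μ|||_c ≤ C(n), a constant depending only on n. -/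
open MeasureTheory Metric Real

noncomputable section

/-- Euclidean space `ℝⁿ`. -/
abbrev Rn (n : ℕ) := EuclideanSpace ℝ (Fin n)

/-- The closed cube with center `x` and sidelength `l`, sides parallel to the axes. -/
def cube (n : ℕ) (x : Rn n) (l : ℝ) : Set (Rn n) :=
  {y | ∀ i, |y i - x i| ≤ l / 2}

/-- The Carleson box `Q̂` over the cube with center `x` and sidelength `l`. -/
def carlesonBox (n : ℕ) (x : Rn n) (l : ℝ) : Set (Rn n × ℝ) :=
  {p | p.1 ∈ cube n x l ∧ 0 < p.2 ∧ p.2 < l}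

/-- The measure `μ = Σ_i t_i^n Φ_{t_i}(·, x_i) ds_i`, where `ds_i` is `n`-dimensional
Lebesgue measure on the hyperplane `{t = t_i}` and `Φ_t(x,y) = t/(t+|x-y|)^{n+1}`. -/
def smearedMeasure (n : ℕ) (x : ℕ → Rn n) (t : ℕ → ℝ) : Measure (Rn n × ℝ) :=
  Measure.sum fun i =>
    ((volume : Measure (Rn n)).withDensity fun y =>
        ENNReal.ofReal ((t i) ^ n * (t i / (t i + dist y (x i)) ^ (n + 1)))).map
      fun y => (y, t i)

theorem measurableSet_cube (n : ℕ) (x : Rn n) (l : ℝ) : MeasurableSet (cube n x l) := by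
  have h : IsClosed (cube n x l) := by
    simp only [cube, Set.ofPred_forall]
    exact isClosed_iInter fun i => isClosed_le (by fun_prop) continuous_const
  exact h.measurableSet

theorem measurableSet_carlesonBox (n : ℕ) (x : Rn n) (l : ℝ) :
    MeasurableSet (carlesonBox n x l) :=
  ((measurableSet_cube n x l).preimage measurable_fst).inter
    (measurableSet_Ioo.preimage measurable_snd)

theorem volume_cube (n : ℕ) (x : Rn n) {l : ℝ} (hl : 0 ≤ l) :
    volume (cube n x l) = ENNReal.ofReal (l ^ n) := by
  have h : cube n x l = (WithLp.ofLp : Rn n → Fin n → ℝ) ⁻¹'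
      Set.Icc (fun i => x i - l / 2) (fun i => x i + l / 2) := by
    ext y
    simp only [cube, Set.mem_ofPred_eq, Set.mem_preimage, Set.mem_Icc, Pi.le_def, abs_le,
      ← forall_and]
    refine forall_congr' fun i => ?_
    constructor <;> rintro ⟨h₁, h₂⟩ <;> constructor <;> linarith
  have hvol := PiLp.volume_preserving_ofLp (Fin n)
  rw [h, hvol.measure_preimage measurableSet_Icc.nullMeasurableSet, Real.volume_Icc_pi]
  simp [ENNReal.ofReal_pow hl]

/-- The total mass of the kernel `Φ_t(·, x)` does not depend on `t` and `x`. -/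
theorem lintegral_smear_kernel (n : ℕ) (x : Rn n) {t : ℝ} (ht : 0 < t) :
    ∫⁻ y : Rn n, ENNReal.ofReal (t / (t + dist y x) ^ (n + 1)) =
      ∫⁻ y : Rn n, ENNReal.ofReal ((1 + ‖y‖) ^ (-((n : ℝ) + 1))) := by
  have hpow (y : Rn n) : (1 + ‖y‖) ^ (-((n : ℝ) + 1)) = ((1 + ‖y‖) ^ (n + 1))⁻¹ := by
    rw [rpow_neg (by positivity)]
    norm_cast
  have hscale (y : Rn n) : t / (t + ‖y‖) ^ (n + 1) =
      (t ^ n)⁻¹ * ((1 + ‖t⁻¹ • y‖) ^ (n + 1))⁻¹ := by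
    have h : t + ‖y‖ = t * (1 + ‖t⁻¹ • y‖) := by
      rw [norm_smul, norm_inv, Real.norm_of_nonneg ht.le]
      field_simp
    rw [h, mul_pow]
    have : (1 + ‖t⁻¹ • y‖) ^ (n + 1) ≠ 0 := by positivity
    field_simp
    ring
  simp_rw [dist_eq_norm, hpow]
  rw [lintegral_sub_right_eq_self (fun y : Rn n => ENNReal.ofReal (t / (t + ‖y‖) ^ (n + 1))) x]
  simp_rw [hscale, ENNReal.ofReal_mul (inv_nonneg.2 (pow_nonneg ht.le n))]
  have hmeas : Measurable fun y : Rn n => ENNReal.ofReal (((1 + ‖y‖) ^ (n + 1))⁻¹) := by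
    fun_prop
  rw [lintegral_const_mul' _ _ ENNReal.ofReal_ne_top,
    ← lintegral_map hmeas (measurable_const_smul t⁻¹),
    Measure.map_addHaar_smul _ (inv_ne_zero ht.ne'), lintegral_smul_measure, smul_eq_mul,
    ← mul_assoc, ← ENNReal.ofReal_mul (by positivity)]
  have : (t ^ n)⁻¹ * |((t⁻¹ ^ Module.finrank ℝ (Rn n))⁻¹)| = 1 := by
    rw [finrank_euclideanSpace_fin, inv_pow, inv_inv, abs_of_pos (by positivity)]
    exact inv_mul_cancel₀ (by positivity)
  rw [this, ENNReal.ofReal_one, one_mul]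

theorem lintegral_one_add_norm_lt_top (n : ℕ) :
    ∫⁻ y : Rn n, ENNReal.ofReal ((1 + ‖y‖) ^ (-((n : ℝ) + 1))) < ⊤ :=
  finite_integral_one_add_norm (by simp)

theorem smearedMeasure_carlesonBox (n : ℕ) (x : ℕ → Rn n) (t : ℕ → ℝ) (x₀ : Rn n) (l : ℝ) :
    smearedMeasure n x t (carlesonBox n x₀ l) = ∑' i,
      ∫⁻ y in {y | (y, t i) ∈ carlesonBox n x₀ l},
        ENNReal.ofReal (t i ^ n * (t i / (t i + dist y (x i)) ^ (n + 1))) := by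
  have hB := measurableSet_carlesonBox n x₀ l
  rw [smearedMeasure, Measure.sum_apply _ hB]
  refine tsum_congr fun i => ?_
  have hm : Measurable fun y : Rn n => (y, t i) := by fun_prop
  rw [Measure.map_apply hm hB, withDensity_apply _ (hm hB)]
  rfl

/-- Off the cube of sidelength `2 ^ (k + 1) * l`, the kernel has little mass on the concentric cube
of sidelength `l`. -/
theorem setLIntegral_smear_kernel_le (n : ℕ) (x x₀ : Rn n) {t l : ℝ} (ht : 0 < t) (htl : t ≤ l)
    {k : ℕ} (hx : x ∉ cube n x₀ (2 ^ (k + 1) * l)) :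
    ∫⁻ y in cube n x₀ l, ENNReal.ofReal (t / (t + dist y x) ^ (n + 1)) ≤
      ENNReal.ofReal (4 ^ (n + 1) * ((1 / 2) ^ (k + 1)) ^ (n + 1)) := by
  have hl : 0 < l := ht.trans_le htl
  have hk : (1 : ℝ) ≤ 2 ^ k := one_le_pow₀ one_le_two
  obtain ⟨i, hi⟩ : ∃ i, 2 ^ (k + 1) * l / 2 < |x i - x₀ i| := by
    simpa [cube] using hx
  have hbound : ∀ y ∈ cube n x₀ l, t / (t + dist y x) ^ (n + 1) ≤
      l / (2 ^ k * l / 2) ^ (n + 1) := by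
    intro y hy
    have hy' := hy i
    have h₁ : |y i - x i| ≤ dist y x := by
      have := PiLp.norm_apply_le (y - x) i
      rwa [← dist_eq_norm] at this
    have h₂ : |x i - x₀ i| ≤ |y i - x i| + |y i - x₀ i| := by
      rw [abs_sub_comm (y i)]
      exact abs_sub_le _ _ _
    have h₃ : l ≤ 2 ^ k * l := le_mul_of_one_le_left hl.le hk
    have h₄ : 2 ^ k * l / 2 ≤ t + dist y x := by
      rw [pow_succ] at hi
      linarith
    gcongr
  calc _ ≤ ∫⁻ _ in cube n x₀ l, ENNReal.ofReal (l / (2 ^ k * l / 2) ^ (n + 1)) :=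
        setLIntegral_mono measurable_const fun y hy => ENNReal.ofReal_le_ofReal (hbound y hy)
    _ = ENNReal.ofReal (4 ^ (n + 1) * ((1 / 2) ^ (k + 1)) ^ (n + 1)) := by
        rw [setLIntegral_const, volume_cube n x₀ hl.le, ← ENNReal.ofReal_mul (by positivity)]
        congr 1
        have h : (4 : ℝ) * (1 / 2) ^ (k + 1) = (2 ^ k / 2)⁻¹ := by
          rw [one_div, inv_pow, pow_succ]
          field_simp
          norm_num
        rw [← mul_pow, h, mul_div_right_comm, mul_pow, inv_pow, pow_succ l]
        field_simp

/-- The mass of the kernel on a cube is controlled by a weighted sum of indicators of dilated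
Carleson boxes. -/
theorem exists_setLIntegral_smear_kernel_le (n : ℕ) (x x₀ : Rn n) {t l : ℝ} (ht : 0 < t)
    (htl : t < l) {A : ℝ} (hA : 4 ^ (n + 1) ≤ A)
    (hA' : ∫⁻ y : Rn n, ENNReal.ofReal ((1 + ‖y‖) ^ (-((n : ℝ) + 1))) ≤ ENNReal.ofReal A) :
    ∃ k : ℕ, (x, t) ∈ carlesonBox n x₀ (2 ^ (k + 1) * l) ∧
      ∫⁻ y in cube n x₀ l, ENNReal.ofReal (t / (t + dist y x) ^ (n + 1)) ≤
        ENNReal.ofReal (A * ((1 / 2) ^ k) ^ (n + 1)) := by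
  have hl : 0 < l := ht.trans htl
  have hex : ∃ k : ℕ, x ∈ cube n x₀ (2 ^ (k + 1) * l) := by
    obtain ⟨k, hk⟩ := pow_unbounded_of_one_lt (‖x - x₀‖ / l) (one_lt_two (α := ℝ))
    refine ⟨k, fun i => ?_⟩
    have h := PiLp.norm_apply_le (x - x₀) i
    rw [div_lt_iff₀ hl] at hk
    rw [pow_succ]
    exact (h.trans hk.le).trans (by linarith)
  classical
  refine ⟨Nat.find hex, ⟨Nat.find_spec hex, ht, htl.trans_le ?_⟩, ?_⟩
  · exact le_mul_of_one_le_left hl.le (one_le_pow₀ one_le_two)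
  · rcases hk : Nat.find hex with _ | k
    · refine (setLIntegral_le_lintegral _ _).trans ?_
      rw [lintegral_smear_kernel n x ht]
      simpa using hA'
    · have hx : x ∉ cube n x₀ (2 ^ (k + 1) * l) := Nat.find_min hex (by omega)
      refine (setLIntegral_smear_kernel_le n x x₀ ht htl.le hx).trans ?_
      gcongr

/-- If `Σ_i t_i^n δ_{(x_i,t_i)}` is a Carleson measure with norm at most `1`, then the
measure obtained by smearing each Dirac mass over the hyperplane `{t = t_i}` with weight
`t_i^n Φ_{t_i}(·, x_i)` is a Carleson measure with norm at most a dimensional constant. -/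
theorem smeared_dirac_carleson (n : ℕ) (hn : 1 ≤ n) :
    ∃ C > 0, ∀ (x : ℕ → Rn n) (t : ℕ → ℝ), (∀ i, 0 < t i) →
      (∀ x₀ l, 0 < l →
        (Measure.sum fun i =>
            (ENNReal.ofReal ((t i) ^ n)) • Measure.dirac ((x i, t i) : Rn n × ℝ))
          (carlesonBox n x₀ l) ≤ ENNReal.ofReal (l ^ n)) →
      ∀ x₀ l, 0 < l →
        smearedMeasure n x t (carlesonBox n x₀ l) ≤ ENNReal.ofReal (C * l ^ n) := by
  obtain ⟨A, hA, hA'⟩ : ∃ A : ℝ, 4 ^ (n + 1) ≤ A ∧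
      ∫⁻ y : Rn n, ENNReal.ofReal ((1 + ‖y‖) ^ (-((n : ℝ) + 1))) ≤ ENNReal.ofReal A :=
    ⟨_, le_max_left _ _, (ENNReal.ofReal_toReal (lintegral_one_add_norm_lt_top n).ne).ge.trans
      (ENNReal.ofReal_le_ofReal (le_max_right _ _))⟩
  have hA₀ : 0 < A := lt_of_lt_of_le (by positivity) hA
  refine ⟨A * 2 ^ n * 2, by positivity, fun x t ht hν x₀ l hl => ?_⟩
  set B : ℕ → Set (Rn n × ℝ) := fun k => carlesonBox n x₀ (2 ^ (k + 1) * l)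
  set a : ℕ → ENNReal := fun k => ENNReal.ofReal (A * ((1 / 2) ^ k) ^ (n + 1))
  have hterm : ∀ i, ∫⁻ y in {y | (y, t i) ∈ carlesonBox n x₀ l},
        ENNReal.ofReal (t i ^ n * (t i / (t i + dist y (x i)) ^ (n + 1))) ≤
      ∑' k, a k * (ENNReal.ofReal (t i ^ n) * (B k).indicator 1 (x i, t i)) := by
    intro i
    by_cases hti : t i < l
    · have hset : {y | (y, t i) ∈ carlesonBox n x₀ l} = cube n x₀ l := by
        ext y
        simp [carlesonBox, ht i, hti]
      obtain ⟨k, hk, hle⟩ := exists_setLIntegral_smear_kernel_le n (x i) x₀ (ht i) hti hA hA'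
      have hk' : (x i, t i) ∈ B k := hk
      refine le_trans ?_ (ENNReal.le_tsum k)
      simp_rw [hset, ENNReal.ofReal_mul (pow_nonneg (ht i).le n)]
      rw [lintegral_const_mul' _ _ ENNReal.ofReal_ne_top, Set.indicator_of_mem hk', Pi.one_apply,
        mul_one, mul_comm (a k)]
      gcongr
    · have hset : {y | (y, t i) ∈ carlesonBox n x₀ l} = ∅ := by
        ext y
        simp [carlesonBox, hti]
      simp [hset]
  have hbox : ∀ k, ∑' i, ENNReal.ofReal (t i ^ n) * (B k).indicator 1 (x i, t i) ≤
      ENNReal.ofReal ((2 ^ (k + 1) * l) ^ n) := by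
    intro k
    have h := hν x₀ (2 ^ (k + 1) * l) (by positivity)
    have hB := measurableSet_carlesonBox n x₀ (2 ^ (k + 1) * l)
    rw [Measure.sum_apply _ hB] at h
    simpa only [Measure.smul_apply, Measure.dirac_apply' _ hB, smul_eq_mul] using h
  have hgeom (k : ℕ) : A * ((1 / 2) ^ k) ^ (n + 1) * (2 ^ (k + 1) * l) ^ n =
      A * 2 ^ n * l ^ n * (1 / 2) ^ k := by
    have h : ((1 : ℝ) / 2) ^ k * 2 ^ k = 1 := by
      rw [← mul_pow]
      norm_num
    calc _ = A * 2 ^ n * l ^ n * (1 / 2) ^ k * ((1 / 2) ^ k * 2 ^ k) ^ n := by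
          rw [mul_pow, mul_pow, pow_succ (2 : ℝ) k, mul_pow]
          ring
      _ = _ := by rw [h, one_pow, mul_one]
  rw [smearedMeasure_carlesonBox]
  calc _ ≤ ∑' i, ∑' k, a k * (ENNReal.ofReal (t i ^ n) * (B k).indicator 1 (x i, t i)) :=
        ENNReal.tsum_le_tsum hterm
    _ = ∑' k, a k * ∑' i, ENNReal.ofReal (t i ^ n) * (B k).indicator 1 (x i, t i) := by
        rw [ENNReal.tsum_comm]
        simp_rw [ENNReal.tsum_mul_left]
    _ ≤ ∑' k, a k * ENNReal.ofReal ((2 ^ (k + 1) * l) ^ n) :=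
        ENNReal.tsum_le_tsum fun k => by gcongr; exact hbox k
    _ = ∑' k : ℕ, ENNReal.ofReal (A * 2 ^ n * l ^ n * (1 / 2) ^ k) := by
        refine tsum_congr fun k => ?_
        rw [← ENNReal.ofReal_mul (by positivity), hgeom]
    _ = ENNReal.ofReal (A * 2 ^ n * 2 * l ^ n) := by
        rw [← ENNReal.ofReal_tsum_of_nonneg (fun k => by positivity)
          (summable_geometric_two.mul_left _), tsum_mul_left, tsum_geometric_two]
        congr 1
        ring
end
end

section
/- Let n ≥ 3 and let V be a nonnegative function on ℝⁿ belonging to the reverse Hölder class B_q for some q ≥ n/2, with V not almost everywhere equal to zero. Then for every x ∈ ℝⁿ the critical radius ρ(x) = sup{ r > 0 : r^{2−n} ∫_{B(x,r)} V(y) dy ≤ 1 } satisfies 0 < ρ(x) < ∞. -/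
open MeasureTheory Metric Real

noncomputable section

/-- `V` belongs to the reverse Hölder class `B_q`: `V` is nonnegative, `V^q` is locally
integrable, and the reverse Hölder inequality holds on every ball. -/
def IsReverseHolder (n : ℕ) (V : Rn n → ℝ) (q : ℝ) : Prop :=
  (∀ y, 0 ≤ V y) ∧
  (∀ (x : Rn n) (r : ℝ), 0 < r → IntegrableOn (fun y => V y ^ q) (ball x r) volume) ∧
  ∃ C > 0, ∀ (x : Rn n) (r : ℝ), 0 < r →
    ((volume (ball x r)).toReal⁻¹ * ∫ y in ball x r, V y ^ q) ^ (1 / q) ≤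
      C * (volume (ball x r)).toReal⁻¹ * ∫ y in ball x r, V y

/-- The set of admissible radii in the definition of the critical radius function. -/
def critSet (n : ℕ) (V : Rn n → ℝ) (x : Rn n) : Set ℝ :=
  {r : ℝ | 0 < r ∧ r ^ ((2 : ℝ) - n) * ∫ y in ball x r, V y ≤ 1}

/-- The critical radius function `ρ(x)` associated to the potential `V`. -/
def critRho (n : ℕ) (V : Rn n → ℝ) (x : Rn n) : ℝ :=
  sSup (critSet n V x)

open Filter Topology

/-- Hölder's inequality against the constant function `1`. -/
lemma setIntegral_le_rpow_mul_measure_rpow {α : Type*} [MeasurableSpace α] {μ : Measure α}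
    {f : α → ℝ} {q : ℝ} {s : Set α} (hq : 1 < q) (hf : ∀ y, 0 ≤ f y) (hs : μ s ≠ ⊤)
    (hint : IntegrableOn (fun y => f y ^ q) s μ) :
    IntegrableOn f s μ ∧
      ∫ y in s, f y ∂μ ≤ (∫ y in s, f y ^ q ∂μ) ^ (1 / q) * (μ s).toReal ^ (1 - 1 / q) := by
  have hq0 : 0 < q := by linarith
  have : IsFiniteMeasure (μ.restrict s) := ⟨by simpa using hs.lt_top⟩
  have hmeas : AEStronglyMeasurable f (μ.restrict s) := by
    have h := (hint.aestronglyMeasurable.aemeasurable.pow_const (1 / q)).aestronglyMeasurable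
    refine h.congr (Eventually.of_forall fun y => ?_)
    simp only [← Real.rpow_mul (hf y), mul_one_div_cancel hq0.ne', Real.rpow_one]
  have hmem : MemLp f (ENNReal.ofReal q) (μ.restrict s) := by
    rw [← integrable_norm_rpow_iff hmeas (by simpa using hq0) ENNReal.ofReal_ne_top,
      ENNReal.toReal_ofReal hq0.le]
    refine hint.congr (Eventually.of_forall fun y => ?_)
    simp [abs_of_nonneg (hf y)]
  refine ⟨hmem.integrable (by simpa using hq.le), ?_⟩
  have hconj : q.HolderConjugate (q.conjExponent) := Real.HolderConjugate.conjExponent hq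
  have h := integral_mul_le_Lp_mul_Lq_of_nonneg hconj (μ := μ.restrict s) (f := f)
    (g := fun _ => (1 : ℝ)) (Eventually.of_forall hf) (Eventually.of_forall fun _ => zero_le_one)
    hmem (memLp_const 1)
  have he : 1 / q.conjExponent = 1 - 1 / q := by
    have := hconj.inv_add_inv_eq_one
    simp only [one_div]; linarith
  rw [he] at h
  simpa [Measure.real] using h

lemma toReal_volume_ball_eq (n : ℕ) (x : Rn n) {r : ℝ} (hr : 0 < r) :
    (volume (ball x r)).toReal = r ^ (n : ℝ) * (volume (ball (0 : Rn n) 1)).toReal := by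
  rw [Measure.addHaar_ball_of_pos _ _ hr]
  simp [ENNReal.toReal_ofReal (pow_nonneg hr.le n)]

lemma toReal_volume_ball_pos (n : ℕ) (x : Rn n) {r : ℝ} (hr : 0 < r) :
    0 < (volume (ball x r)).toReal :=
  ENNReal.toReal_pos (measure_ball_pos volume x hr).ne' measure_ball_lt_top.ne

/-- The reverse Hölder inequality with the volume factors collected on the left. -/
lemma IsReverseHolder.exists_measure_rpow_mul_le {n : ℕ} {V : Rn n → ℝ} {q : ℝ}
    (hV : IsReverseHolder n V q) :
    ∃ C > 0, ∀ (x : Rn n) (r : ℝ), 0 < r →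
      (volume (ball x r)).toReal ^ (1 - 1 / q) * (∫ y in ball x r, V y ^ q) ^ (1 / q) ≤
        C * ∫ y in ball x r, V y := by
  obtain ⟨hV0, -, C, hC, h⟩ := hV
  refine ⟨C, hC, fun x r hr => ?_⟩
  have hm := toReal_volume_ball_pos n x hr
  have h := h x r hr
  set m := (volume (ball x r)).toReal
  have hJ : 0 ≤ ∫ y in ball x r, V y ^ q := integral_nonneg fun y => Real.rpow_nonneg (hV0 y) _
  rw [Real.mul_rpow (inv_nonneg.2 hm.le) hJ, Real.inv_rpow hm.le] at h
  rw [Real.rpow_sub hm, Real.rpow_one]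
  calc m / m ^ (1 / q) * (∫ y in ball x r, V y ^ q) ^ (1 / q)
      = m * ((m ^ (1 / q))⁻¹ * (∫ y in ball x r, V y ^ q) ^ (1 / q)) := by ring
    _ ≤ m * (C * m⁻¹ * ∫ y in ball x r, V y) := by gcongr
    _ = C * ∫ y in ball x r, V y := by field_simp

/-- If `V ∈ B_q` is not a.e. zero, then `V ^ q` has infinite mass. -/
lemma IsReverseHolder.not_integrable_rpow {n : ℕ} (hn : n ≠ 0) {V : Rn n → ℝ} {q : ℝ}
    (hq : 1 < q) (hV : IsReverseHolder n V q)
    (hV0 : ¬ V =ᵐ[(volume : Measure (Rn n))] 0) :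
    ¬ Integrable (fun y => V y ^ q) volume := by
  intro hint
  have hq0 : 0 < q := by linarith
  obtain ⟨C, hC, hrev⟩ := hV.exists_measure_rpow_mul_le
  have hnn := hV.1
  have hWnn : ∀ y, 0 ≤ V y ^ q := fun y => Real.rpow_nonneg (hnn y) _
  set I := ∫ y, V y ^ q with hI
  have hIpos : 0 < I := by
    refine lt_of_le_of_ne (integral_nonneg hWnn) fun h0 => hV0 ?_
    have := (integral_eq_zero_iff_of_nonneg hWnn hint).1 h0.symm
    filter_upwards [this] with y hy
    exact (Real.rpow_eq_zero (hnn y) hq0.ne').1 hy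
  have hlim : Tendsto (fun k : ℕ => ∫ y in ball (0 : Rn n) k, V y ^ q) atTop (𝓝 I) :=
    (aecover_ball (μ := volume) (x := (0 : Rn n))
      tendsto_natCast_atTop_atTop).integral_tendsto_of_countably_generated hint
  set δ := (I / 2) / (2 * C) ^ q with hδ
  have hδpos : 0 < δ := by positivity
  obtain ⟨k₀, hk₀I, hk₀δ⟩ := ((hlim.eventually (lt_mem_nhds (half_lt_self hIpos))).and
    (hlim.eventually (lt_mem_nhds (sub_lt_self I hδpos)))).exists
  set c := (I / 2) ^ (1 / q) with hc
  have hcpos : 0 < c := by positivity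
  have hδc : δ ^ (1 / q) = c / (2 * C) := by
    rw [hδ, Real.div_rpow (by positivity) (by positivity), ← Real.rpow_mul (by positivity),
      mul_one_div_cancel hq0.ne', Real.rpow_one]
  have hexp : 0 < 1 - 1 / q := by
    have : 1 / q < 1 := by rw [div_lt_one hq0]; exact hq
    linarith
  have hbound : ∀ k : ℕ, k₀ ≤ k → 0 < k →
      (volume (ball (0 : Rn n) k)).toReal ^ (1 - 1 / q) * (c / 2) ≤
        C * ∫ y in ball (0 : Rn n) k₀, V y := by
    intro k hk hk0
    have hsub : ball (0 : Rn n) k₀ ⊆ ball 0 k := ball_subset_ball (by exact_mod_cast hk)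
    have h1 := hrev 0 k (by exact_mod_cast hk0)
    have hVk := (setIntegral_le_rpow_mul_measure_rpow (μ := volume) hq hnn
      (measure_ball_lt_top (x := (0 : Rn n)) (r := (k : ℝ))).ne hint.integrableOn).1
    obtain ⟨-, hd⟩ := setIntegral_le_rpow_mul_measure_rpow (μ := volume)
      (s := ball (0 : Rn n) k \ ball 0 k₀) hq hnn
      (measure_ne_top_of_subset Set.sdiff_subset measure_ball_lt_top.ne) hint.integrableOn
    have hsplit : ∫ y in ball (0 : Rn n) k \ ball 0 k₀, V y =
        (∫ y in ball (0 : Rn n) k, V y) - ∫ y in ball (0 : Rn n) k₀, V y :=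
      setIntegral_sdiff measurableSet_ball hVk hsub
    have htail : ∫ y in ball (0 : Rn n) k \ ball 0 k₀, V y ^ q ≤ δ := by
      have h2 : ∫ y in ball (0 : Rn n) k \ ball 0 k₀, V y ^ q =
          (∫ y in ball (0 : Rn n) k, V y ^ q) - ∫ y in ball (0 : Rn n) k₀, V y ^ q :=
        setIntegral_sdiff measurableSet_ball hint.integrableOn hsub
      have h3 : ∫ y in ball (0 : Rn n) k, V y ^ q ≤ I :=
        setIntegral_le_integral hint (Eventually.of_forall hWnn)
      linarith
    have hJ : I / 2 ≤ ∫ y in ball (0 : Rn n) k, V y ^ q :=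
      hk₀I.le.trans (setIntegral_mono_set hint.integrableOn (Eventually.of_forall hWnn)
        hsub.eventuallyLE)
    set M := (volume (ball (0 : Rn n) k)).toReal ^ (1 - 1 / q) with hM
    have hMnn : 0 ≤ M := by positivity
    have hM' : (volume (ball (0 : Rn n) k \ ball 0 k₀)).toReal ^ (1 - 1 / q) ≤ M := by
      refine Real.rpow_le_rpow ENNReal.toReal_nonneg ?_ hexp.le
      exact ENNReal.toReal_mono measure_ball_lt_top.ne (measure_mono Set.sdiff_subset)
    have h4 : ∫ y in ball (0 : Rn n) k \ ball 0 k₀, V y ≤ c / (2 * C) * M := by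
      refine hd.trans (mul_le_mul ?_ hM' (by positivity) (by positivity))
      rw [← hδc]
      exact Real.rpow_le_rpow (integral_nonneg hWnn) htail (by positivity)
    have h5 : M * c ≤ C * ∫ y in ball (0 : Rn n) k, V y := by
      refine le_trans ?_ h1
      rw [hc]
      gcongr
    have h6 : C * (c / (2 * C) * M) = M * (c / 2) := by field_simp
    have h7 := mul_le_mul_of_nonneg_left h4 hC.le
    rw [hsplit, h6] at h7
    linarith
  have hω := toReal_volume_ball_pos n (0 : Rn n) one_pos
  have htop : Tendsto (fun k : ℕ => (volume (ball (0 : Rn n) k)).toReal ^ (1 - 1 / q) * (c / 2))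
      atTop atTop := by
    refine Tendsto.atTop_mul_const (by positivity) ((tendsto_rpow_atTop hexp).comp ?_)
    have : Tendsto (fun k : ℕ => (k : ℝ) ^ (n : ℝ) * (volume (ball (0 : Rn n) 1)).toReal)
        atTop atTop :=
      ((tendsto_rpow_atTop (by positivity)).comp tendsto_natCast_atTop_atTop).atTop_mul_const hω
    refine this.congr' ?_
    filter_upwards [eventually_gt_atTop 0] with k hk
    exact (toReal_volume_ball_eq n 0 (by exact_mod_cast hk)).symm
  obtain ⟨k, hk, hk₀, hkpos⟩ := ((htop.eventually (eventually_gt_atTop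
    (C * ∫ y in ball (0 : Rn n) k₀, V y))).and
      ((eventually_ge_atTop k₀).and (eventually_gt_atTop 0))).exists
  exact (hbound k hk₀ hkpos).not_gt hk

lemma toReal_volume_ball_rpow (n : ℕ) (x : Rn n) {q r : ℝ} (hr : 0 < r) :
    (volume (ball x r)).toReal ^ (1 - 1 / q) =
      r ^ (n - n / q : ℝ) * (volume (ball (0 : Rn n) 1)).toReal ^ (1 - 1 / q) := by
  rw [toReal_volume_ball_eq n x hr, Real.mul_rpow (by positivity) ENNReal.toReal_nonneg,
    ← Real.rpow_mul hr.le]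
  congr 2
  ring

lemma IsReverseHolder.critSet_nonempty {n : ℕ} (hn : n ≠ 0) {V : Rn n → ℝ} {q : ℝ} (hq1 : 1 < q)
    (hq : (n : ℝ) / 2 ≤ q) (hV : IsReverseHolder n V q) (x : Rn n) :
    (critSet n V x).Nonempty := by
  have hq0 : 0 < q := by linarith
  set w := (volume (ball (0 : Rn n) 1)).toReal ^ (1 - 1 / q) with hw
  have hvol : Tendsto (fun r : ℝ => volume (ball x r)) (𝓝[>] 0) (𝓝 0) := by
    have h : Tendsto (fun r : ℝ => ENNReal.ofReal (r ^ n) * volume (ball (0 : Rn n) 1))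
        (𝓝 0) (𝓝 0) := by
      have h1 : Tendsto (fun r : ℝ => ENNReal.ofReal (r ^ n)) (𝓝 0) (𝓝 0) := by
        have : Continuous fun r : ℝ => ENNReal.ofReal (r ^ n) :=
          ENNReal.continuous_ofReal.comp (continuous_pow n)
        simpa [hn] using this.tendsto 0
      simpa using ENNReal.Tendsto.mul_const h1 (Or.inr measure_ball_lt_top.ne)
    refine (h.mono_left nhdsWithin_le_nhds).congr' ?_
    filter_upwards [self_mem_nhdsWithin] with r hr
    rw [Measure.addHaar_ball_of_pos _ _ hr]
    simp
  have hJ : Tendsto (fun r : ℝ => ∫ y in ball x r, V y ^ q) (𝓝[>] 0) (𝓝 0) := by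
    have hi := (integrable_indicator_iff measurableSet_ball).2 (hV.2.1 x 1 one_pos)
    refine (hi.tendsto_setIntegral_nhds_zero hvol).congr' ?_
    filter_upwards [Ioo_mem_nhdsGT (zero_lt_one' ℝ)] with r hr
    refine setIntegral_congr_fun measurableSet_ball fun y hy => ?_
    exact Set.indicator_of_mem (ball_subset_ball hr.2.le hy) _
  have hlim : Tendsto (fun r : ℝ => (∫ y in ball x r, V y ^ q) ^ (1 / q) * w) (𝓝[>] 0) (𝓝 0) := by
    have h := (hJ.rpow_const (p := 1 / q) (Or.inr (by positivity))).mul_const w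
    rwa [Real.zero_rpow (by positivity), zero_mul] at h
  obtain ⟨r, hr1, hr⟩ := ((hlim.eventually (gt_mem_nhds one_pos)).and
    (Ioo_mem_nhdsGT (zero_lt_one' ℝ))).exists
  refine ⟨r, hr.1, ?_⟩
  have hr0 : 0 < r := hr.1
  have hH := (setIntegral_le_rpow_mul_measure_rpow (μ := volume) hq1 hV.1
    measure_ball_lt_top.ne (hV.2.1 x r hr.1)).2
  rw [toReal_volume_ball_rpow n x hr.1, ← hw] at hH
  have hJnn : 0 ≤ (∫ y in ball x r, V y ^ q) ^ (1 / q) :=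
    Real.rpow_nonneg (integral_nonneg fun y => Real.rpow_nonneg (hV.1 y) _) _
  have hexp : 0 ≤ (2 : ℝ) - n / q := by
    have : (n : ℝ) / q ≤ 2 := by rw [div_le_iff₀ hq0]; linarith
    linarith
  calc r ^ ((2 : ℝ) - n) * ∫ y in ball x r, V y
      ≤ r ^ ((2 : ℝ) - n) * ((∫ y in ball x r, V y ^ q) ^ (1 / q) *
          (r ^ (n - n / q : ℝ) * w)) := by gcongr
    _ = r ^ ((2 : ℝ) - n / q) * ((∫ y in ball x r, V y ^ q) ^ (1 / q) * w) := by
        rw [show (2 : ℝ) - n / q = (2 - n) + (n - n / q) by ring, Real.rpow_add hr.1]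
        ring
    _ ≤ 1 * 1 := mul_le_mul (Real.rpow_le_one hr.1.le hr.2.le hexp) hr1.le
        (by positivity) zero_le_one
    _ = 1 := one_mul 1

lemma IsReverseHolder.critSet_bddAbove {n : ℕ} (hn : n ≠ 0) {V : Rn n → ℝ} {q : ℝ} (hq1 : 1 < q)
    (hq : (n : ℝ) / 2 ≤ q) (hV : IsReverseHolder n V q)
    (hV0 : ¬ V =ᵐ[(volume : Measure (Rn n))] 0) (x : Rn n) :
    BddAbove (critSet n V x) := by
  have hq0 : 0 < q := by linarith
  by_contra hunb
  rw [not_bddAbove_iff] at hunb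
  refine hV.not_integrable_rpow hn hq1 hV0 ?_
  obtain ⟨C, hC, hrev⟩ := hV.exists_measure_rpow_mul_le
  have hWnn : ∀ y, 0 ≤ V y ^ q := fun y => Real.rpow_nonneg (hV.1 y) _
  have hω := toReal_volume_ball_pos n (0 : Rn n) one_pos
  set w := (volume (ball (0 : Rn n) 1)).toReal ^ (1 - 1 / q) with hw
  have hwpos : 0 < w := by positivity
  have hexp : (n : ℝ) / q - 2 ≤ 0 := by
    have : (n : ℝ) / q ≤ 2 := by rw [div_le_iff₀ hq0]; linarith
    linarith
  have hbound : ∀ r ∈ critSet n V x, 1 ≤ r → ∫ y in ball x r, V y ^ q ≤ (C / w) ^ q := by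
    rintro r ⟨hr0, hr⟩ hr1
    have h := hrev x r hr0
    rw [toReal_volume_ball_rpow n x hr0, ← hw] at h
    set J := ∫ y in ball x r, V y ^ q
    have hJ : 0 ≤ J := integral_nonneg hWnn
    have hJw : J ^ (1 / q) ≤ C / w := by
      rw [le_div_iff₀ hwpos]
      calc J ^ (1 / q) * w
          = r ^ ((n : ℝ) / q - 2) * (r ^ ((2 : ℝ) - n) * (r ^ (n - n / q : ℝ) * w * J ^ (1 / q))) := by
            have : r ^ ((n : ℝ) / q - 2) * (r ^ ((2 : ℝ) - n) * r ^ (n - n / q : ℝ)) = 1 := by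
              rw [← Real.rpow_add hr0, ← Real.rpow_add hr0]
              ring_nf
              exact Real.rpow_zero r
            linear_combination (-(J ^ (1 / q) * w)) * this
        _ ≤ r ^ ((n : ℝ) / q - 2) * (r ^ ((2 : ℝ) - n) * (C * ∫ y in ball x r, V y)) := by gcongr
        _ = r ^ ((n : ℝ) / q - 2) * (C * (r ^ ((2 : ℝ) - n) * ∫ y in ball x r, V y)) := by ring
        _ ≤ 1 * (C * 1) := by
            have hVi : 0 ≤ ∫ y in ball x r, V y := integral_nonneg hV.1
            exact mul_le_mul (Real.rpow_le_one_of_one_le_of_nonpos hr1 hexp)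
              (by gcongr) (by positivity) zero_le_one
        _ = C := by ring
    calc J = (J ^ (1 / q)) ^ q := by
          rw [← Real.rpow_mul hJ, one_div_mul_cancel hq0.ne', Real.rpow_one]
      _ ≤ (C / w) ^ q := by gcongr
  refine (aecover_ball (μ := volume) (x := x)
    tendsto_natCast_atTop_atTop).integrable_of_integral_bounded_of_nonneg_ae
      ((C / w) ^ q) (fun k : ℕ => ?_) (Eventually.of_forall hWnn)
      (Eventually.of_forall fun k : ℕ => ?_)
  · exact (hV.2.1 x (k + 1) (by positivity)).mono_set (ball_subset_ball (by linarith))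
  · obtain ⟨r, hr, hkr⟩ := hunb (max k 1)
    have hkr' := max_lt_iff.1 hkr
    exact (setIntegral_mono_set (hV.2.1 x r hr.1) (Eventually.of_forall hWnn)
      (ball_subset_ball hkr'.1.le).eventuallyLE).trans (hbound r hr hkr'.2.le)

/-- For `n ≥ 3` and a nonnegative `V ∈ B_q`, `q ≥ n/2`, not a.e. zero, the critical
radius satisfies `0 < ρ(x) < ∞` for every `x`. -/
theorem critRho_pos_finite (n : ℕ) (hn : 3 ≤ n) (V : Rn n → ℝ) (q : ℝ)
    (hq : (n : ℝ) / 2 ≤ q) (hV : IsReverseHolder n V q)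
    (hV0 : ¬ V =ᵐ[(volume : Measure (Rn n))] 0) :
    ∀ x : Rn n, (critSet n V x).Nonempty ∧ BddAbove (critSet n V x) ∧
      0 < critRho n V x := by
  have hn' : (3 : ℝ) ≤ n := by exact_mod_cast hn
  have hq1 : 1 < q := by linarith
  have hn0 : n ≠ 0 := by omega
  intro x
  have hne := hV.critSet_nonempty hn0 hq1 hq x
  have hbdd := hV.critSet_bddAbove hn0 hq1 hq hV0 x
  obtain ⟨r, hr⟩ := hne
  exact ⟨⟨r, hr⟩, hbdd, hr.1.trans_le (le_csSup hbdd hr)⟩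
end
end

section
/- Let n ≥ 3 and let V ∈ B_q for some q > n/2 be nonnegative and not almost everywhere zero, with critical radius function ρ. Then there exists a constant C' ≥ 1 such that for all x, y ∈ ℝⁿ with |x − y| ≤ ρ(x), one has (C')^{−1} ρ(x) ≤ ρ(y) ≤ C' ρ(x); that is, ρ(x) and ρ(y) are comparable whenever y lies in the ball B(x, ρ(x)). -/
open MeasureTheory Metric Real

noncomputable section

namespace IsReverseHolder

variable {n : ℕ} {V : Rn n → ℝ} {q : ℝ}

lemma memLp_ball (hV : IsReverseHolder n V q) (hq : 1 < q) (x : Rn n) {r : ℝ} (hr : 0 < r) :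
    MemLp V (ENNReal.ofReal q) (volume.restrict (ball x r)) := by
  obtain ⟨h0, hint, -⟩ := hV
  have hq0 : 0 < q := by linarith
  have hi := hint x r hr
  have hmeas : AEStronglyMeasurable V (volume.restrict (ball x r)) := by
    have h1 : AEMeasurable (fun y => (V y ^ q) ^ q⁻¹) (volume.restrict (ball x r)) :=
      hi.aestronglyMeasurable.aemeasurable.pow_const _
    have h2 : (fun y => (V y ^ q) ^ q⁻¹) = V := by
      funext y
      exact Real.rpow_rpow_inv (h0 y) hq0.ne'
    rw [h2] at h1
    exact h1.aestronglyMeasurable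
  rw [← integrable_norm_rpow_iff hmeas (by simpa using hq0) ENNReal.ofReal_ne_top,
    ENNReal.toReal_ofReal hq0.le]
  refine hi.congr (Filter.Eventually.of_forall fun y => ?_)
  simp only [Real.norm_of_nonneg (h0 y)]

lemma integrableOn_ball (hV : IsReverseHolder n V q) (hq : 1 < q) (x : Rn n) (r : ℝ) :
    IntegrableOn V (ball x r) := by
  rcases le_or_gt r 0 with hr | hr
  · simp [ball_eq_empty.2 hr]
  · have : IsFiniteMeasure (volume.restrict (ball x r)) := ⟨by simp [measure_ball_lt_top]⟩
    exact (hV.memLp_ball hq x hr).integrable (by simpa using hq.le)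

lemma setIntegral_mono_of_subset_ball (hV : IsReverseHolder n V q) (hq : 1 < q) {s : Set (Rn n)}
    {x : Rn n} {r : ℝ} (hs : s ⊆ ball x r) : ∫ y in s, V y ≤ ∫ y in ball x r, V y :=
  setIntegral_mono_set (hV.integrableOn_ball hq x r) (Filter.Eventually.of_forall hV.1)
    hs.eventuallyLE

/-- The `A_∞` property: a measurable part of a ball which is small in volume carries a small
proportion of the mass of `V`. -/
lemma exists_setIntegral_le (hV : IsReverseHolder n V q) (hq : 1 < q) :
    ∃ C > 0, ∀ (x : Rn n) (r : ℝ) (s : Set (Rn n)), 0 < r → s ⊆ ball x r →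
      ∫ y in s, V y ≤
        C * (volume.real s / volume.real (ball x r)) ^ (1 - 1 / q) * ∫ y in ball x r, V y := by
  have hV' := hV
  obtain ⟨h0, hint, C, hC, hRH⟩ := hV'
  refine ⟨C, hC, fun x r s hr hs => ?_⟩
  have hq0 : 0 < q := by linarith
  have hb : 0 < volume.real (ball x r) :=
    ENNReal.toReal_pos (measure_ball_pos volume x hr).ne' measure_ball_lt_top.ne
  have hpq : q.HolderConjugate (q / (q - 1)) := Real.HolderConjugate.conjExponent hq
  have hexp : 1 / (q / (q - 1)) = 1 - 1 / q := by field_simp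
  have hsfin : volume s ≠ ⊤ := measure_ne_top_of_subset hs measure_ball_lt_top.ne
  have : IsFiniteMeasure (volume.restrict s) := ⟨by simpa using hsfin.lt_top⟩
  have hold := integral_mul_le_Lp_mul_Lq_of_nonneg (μ := volume.restrict s) hpq
    (f := V) (g := fun _ => 1) (Filter.Eventually.of_forall h0)
    (Filter.Eventually.of_forall fun _ => zero_le_one)
    ((hV.memLp_ball hq x hr).mono_measure (Measure.restrict_mono hs le_rfl)) (memLp_const 1)
  rw [hexp] at hold
  simp only [mul_one, Real.one_rpow, integral_const, smul_eq_mul,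
    measureReal_restrict_apply_univ] at hold
  have hpow : ∫ y in s, V y ^ q ≤ ∫ y in ball x r, V y ^ q :=
    setIntegral_mono_set (hint x r hr)
      (Filter.Eventually.of_forall fun y => Real.rpow_nonneg (h0 y) q) hs.eventuallyLE
  have hA0 : 0 ≤ ∫ y in s, V y ^ q := integral_nonneg fun y => Real.rpow_nonneg (h0 y) q
  have hB0 : 0 ≤ ∫ y in ball x r, V y ^ q := integral_nonneg fun y => Real.rpow_nonneg (h0 y) q
  have hrev := hRH x r hr
  change ((volume.real (ball x r))⁻¹ * _) ^ (1 / q) ≤ C * (volume.real (ball x r))⁻¹ * _ at hrev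
  set b := volume.real (ball x r)
  have he : 0 ≤ volume.real s := measureReal_nonneg
  set e := volume.real s
  set I := ∫ y in ball x r, V y
  set J := ∫ y in ball x r, V y ^ q
  have hJ : J ^ (1 / q) = b ^ (1 / q) * (b⁻¹ * J) ^ (1 / q) := by
    rw [← Real.mul_rpow hb.le (by positivity), mul_inv_cancel_left₀ hb.ne']
  calc ∫ y in s, V y ≤ _ := hold
    _ ≤ J ^ (1 / q) * e ^ (1 - 1 / q) := by gcongr
    _ = b ^ (1 / q) * (b⁻¹ * J) ^ (1 / q) * e ^ (1 - 1 / q) := by rw [hJ]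
    _ ≤ b ^ (1 / q) * (C * b⁻¹ * I) * e ^ (1 - 1 / q) := by gcongr
    _ = C * (e / b) ^ (1 - 1 / q) * I := by
      rw [Real.div_rpow he hb.le, Real.rpow_sub hb, Real.rpow_one]
      field_simp

lemma volume_real_ball (x : Rn n) {r : ℝ} (hr : 0 < r) :
    volume.real (ball x r) = r ^ n * volume.real (ball (0 : Rn n) 1) := by
  rw [measureReal_def, Measure.addHaar_ball_of_pos volume x hr, finrank_euclideanSpace_fin,
    ENNReal.toReal_mul, ENNReal.toReal_ofReal (by positivity), measureReal_def]

lemma volume_real_ball_div (x : Rn n) {r R : ℝ} (hr : 0 < r) (hR : 0 < R) :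
    volume.real (ball x r) / volume.real (ball x R) = (r / R) ^ n := by
  have h1 : 0 < volume.real (ball (0 : Rn n) 1) :=
    ENNReal.toReal_pos (measure_ball_pos volume _ one_pos).ne' measure_ball_lt_top.ne
  rw [volume_real_ball x hr, volume_real_ball x hR, div_pow]
  field_simp

/-- Growth of the normalized mass `r ^ (2 - n) * ∫_{B(x,r)} V` in `r`. -/
lemma exists_growth (hV : IsReverseHolder n V q) (hq : 1 < q) :
    ∃ C > 0, ∀ (x : Rn n) (r R : ℝ), 0 < r → r ≤ R →
      r ^ ((2 : ℝ) - n) * ∫ y in ball x r, V y ≤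
        C * (r / R) ^ (2 - n / q) * (R ^ ((2 : ℝ) - n) * ∫ y in ball x R, V y) := by
  obtain ⟨C, hC, h⟩ := hV.exists_setIntegral_le hq
  refine ⟨C, hC, fun x r R hr hrR => ?_⟩
  have hR : 0 < R := hr.trans_le hrR
  have h1 := h x R (ball x r) hR (ball_subset_ball hrR)
  rw [volume_real_ball_div x hr hR, ← Real.rpow_natCast, ← Real.rpow_mul (by positivity)] at h1
  have hrw : r ^ ((2 : ℝ) - n) = (r / R) ^ ((2 : ℝ) - n) * R ^ ((2 : ℝ) - n) := by
    rw [← Real.mul_rpow (by positivity) hR.le, div_mul_cancel₀ _ hR.ne']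
  have hexp : (2 : ℝ) - n / q = (2 - n) + n * (1 - 1 / q) := by ring
  calc _ ≤ r ^ ((2 : ℝ) - n) * (C * (r / R) ^ ((n : ℝ) * (1 - 1 / q)) * ∫ y in ball x R, V y) := by
        gcongr
    _ = _ := by
        rw [hexp, Real.rpow_add (by positivity), hrw]
        ring

/-- The measure `V dx` of a ball is controlled by that of a slightly smaller concentric ball. -/
lemma exists_shrink (hV : IsReverseHolder n V q) (hq : 1 < q) :
    ∃ θ : ℝ, 0 < θ ∧ θ < 1 ∧ ∀ (x : Rn n) (R : ℝ), 0 < R →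
      ∫ y in ball x R, V y ≤ 2 * ∫ y in ball x (θ * R), V y := by
  obtain ⟨C, hC, h⟩ := hV.exists_setIntegral_le hq
  have hα : 0 < 1 - 1 / q := by
    rw [sub_pos, div_lt_one (by linarith)]
    exact hq
  have hcont : Continuous fun t : ℝ => C * (1 - t ^ n) ^ (1 - 1 / q) :=
    continuous_const.mul ((by fun_prop : Continuous fun t : ℝ => 1 - t ^ n).rpow_const
      fun _ => Or.inr hα.le)
  have hev : ∀ᶠ t in nhds (1 : ℝ), C * (1 - t ^ n) ^ (1 - 1 / q) < 1 / 2 :=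
    (hcont.tendsto 1).eventually_lt_const (by
      rw [one_pow, sub_self, Real.zero_rpow hα.ne']
      norm_num)
  obtain ⟨θ, hθ, hθ0, hθ1⟩ := ((hev.filter_mono nhdsWithin_le_nhds).and
    (Ioo_mem_nhdsLT (zero_lt_one (α := ℝ)))).exists
  refine ⟨θ, hθ0, hθ1, fun x R hR => ?_⟩
  have hsub : ball x (θ * R) ⊆ ball x R := ball_subset_ball (by nlinarith)
  have hb : 0 < volume.real (ball x R) :=
    ENNReal.toReal_pos (measure_ball_pos volume x hR).ne' measure_ball_lt_top.ne
  have h1 := h x R (ball x R \ ball x (θ * R)) hR Set.sdiff_subset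
  rw [measureReal_sdiff hsub measurableSet_ball measure_ball_lt_top.ne, sub_div,
    div_self hb.ne', volume_real_ball_div x (by positivity) hR, mul_div_cancel_right₀ _ hR.ne',
    setIntegral_sdiff measurableSet_ball (hV.integrableOn_ball hq x R) hsub] at h1
  have hI : 0 ≤ ∫ y in ball x R, V y := integral_nonneg hV.1
  nlinarith [mul_le_mul_of_nonneg_right hθ.le hI]

lemma exists_doubling (hV : IsReverseHolder n V q) (hq : 1 < q) {ε : ℝ} (hε : 0 < ε) :
    ∃ D > 0, ∀ (x : Rn n) (R : ℝ), 0 < R →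
      ∫ y in ball x R, V y ≤ D * ∫ y in ball x (ε * R), V y := by
  obtain ⟨θ, hθ0, hθ1, h⟩ := hV.exists_shrink hq
  obtain ⟨k, hk⟩ := exists_pow_lt_of_lt_one hε hθ1
  refine ⟨2 ^ k, by positivity, fun x R hR => ?_⟩
  have hiter : ∀ j : ℕ, ∫ y in ball x R, V y ≤ 2 ^ j * ∫ y in ball x (θ ^ j * R), V y := by
    intro j
    induction j with
    | zero => simp
    | succ j ih =>
      have h1 := h x (θ ^ j * R) (by positivity)
      rw [← mul_assoc, ← pow_succ'] at h1
      calc _ ≤ _ := ih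
        _ ≤ 2 ^ j * (2 * ∫ y in ball x (θ ^ (j + 1) * R), V y) := by gcongr
        _ = _ := by ring
  exact (hiter k).trans (mul_le_mul_of_nonneg_left (hV.setIntegral_mono_of_subset_ball hq
    (ball_subset_ball (by gcongr))) (by positivity))

lemma exists_setIntegral_ball_pos (hV : IsReverseHolder n V q) (hq : 1 < q)
    (hV0 : ¬ V =ᵐ[(volume : Measure (Rn n))] 0) (x : Rn n) :
    ∃ r > 0, 0 < ∫ y in ball x r, V y := by
  by_contra! hcon
  apply hV0
  have hae : ∀ k : ℕ, ∀ᵐ y ∂volume, y ∈ ball x ((k : ℝ) + 1) → V y = 0 := by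
    intro k
    have hz : ∫ y in ball x ((k : ℝ) + 1), V y = 0 :=
      (hcon _ (by positivity)).antisymm (integral_nonneg hV.1)
    rw [integral_eq_zero_iff_of_nonneg hV.1 (hV.integrableOn_ball hq _ _)] at hz
    exact (ae_restrict_iff' measurableSet_ball).1 hz
  filter_upwards [ae_all_iff.2 hae] with y hy
  obtain ⟨k, hk⟩ := exists_nat_gt (dist y x)
  exact hy k (mem_ball.2 (by linarith))

lemma bddAbove_critSet (hV : IsReverseHolder n V q) (hq : 1 < q) (hnq : (n : ℝ) / q < 2)
    (hV0 : ¬ V =ᵐ[(volume : Measure (Rn n))] 0) (x : Rn n) : BddAbove (critSet n V x) := by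
  obtain ⟨C, hC, hgrow⟩ := hV.exists_growth hq
  obtain ⟨r, hr, hpos⟩ := hV.exists_setIntegral_ball_pos hq hV0 x
  have hφ : 0 < r ^ ((2 : ℝ) - n) * ∫ y in ball x r, V y := by positivity
  set φ := r ^ ((2 : ℝ) - n) * ∫ y in ball x r, V y
  have hδ : 0 < 2 - n / q := by linarith
  refine ⟨max r (r * (C / φ) ^ (2 - n / q)⁻¹), fun s hs => ?_⟩
  rcases le_total s r with hsr | hrs
  · exact le_max_of_le_left hsr
  refine le_max_of_le_right ?_
  have hs0 : 0 < s := hs.1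
  have h1 : φ ≤ C * (r / s) ^ (2 - n / q) :=
    (hgrow x r s hr hrs).trans (mul_le_of_le_one_right (by positivity) hs.2)
  have h2 : (s / r) ^ (2 - n / q) ≤ C / φ := by
    rw [le_div_iff₀ hφ]
    calc _ ≤ (s / r) ^ (2 - n / q) * (C * (r / s) ^ (2 - n / q)) := by gcongr
      _ = C * ((s / r) * (r / s)) ^ (2 - n / q) := by
        rw [Real.mul_rpow (by positivity) (by positivity)]; ring
      _ = C := by
        rw [div_mul_div_cancel₀ hr.ne', div_self hs0.ne', Real.one_rpow, mul_one]
  have h3 := (Real.le_rpow_inv_iff_of_pos (by positivity) (by positivity) hδ).2 h2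
  rw [div_le_iff₀ hr] at h3
  linarith

end IsReverseHolder

/-- For `n ≥ 3` and nonnegative `V ∈ B_q`, `q > n/2`, not a.e. zero, the critical radius
function is comparable at points `y` with `|x - y| ≤ ρ(x)`:
`(C')⁻¹ ρ(x) ≤ ρ(y) ≤ C' ρ(x)`. -/
theorem critRho_comparable (n : ℕ) (hn : 3 ≤ n) (V : Rn n → ℝ) (q : ℝ)
    (hq : (n : ℝ) / 2 < q) (hV : IsReverseHolder n V q)
    (hV0 : ¬ V =ᵐ[(volume : Measure (Rn n))] 0) :
    ∃ C' : ℝ, 1 ≤ C' ∧ ∀ x y : Rn n, dist x y ≤ critRho n V x →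
      (C')⁻¹ * critRho n V x ≤ critRho n V y ∧ critRho n V y ≤ C' * critRho n V x := by
  have hn' : (3 : ℝ) ≤ n := by exact_mod_cast hn
  have hq1 : 1 < q := by linarith
  have hnq : (n : ℝ) / q < 2 := by
    rw [div_lt_iff₀ (by linarith)]
    linarith
  have hδ : 0 < 2 - n / q := by linarith
  obtain ⟨C, hC, hgrow⟩ := hV.exists_growth hq1
  obtain ⟨D, hD, hdoub⟩ := hV.exists_doubling hq1 (show (0 : ℝ) < 1 / 4 by norm_num)
  have hbdd := hV.bddAbove_critSet hq1 hnq hV0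
  set δ : ℝ := 2 - n / q
  set t : ℝ := min 1 ((C * D)⁻¹ ^ δ⁻¹)
  have ht0 : 0 < t := lt_min one_pos (by positivity)
  have htδ : C * t ^ δ * D ≤ 1 := by
    have : t ^ δ ≤ (C * D)⁻¹ :=
      (Real.le_rpow_inv_iff_of_pos ht0.le (by positivity) hδ).1 (min_le_right _ _)
    calc C * t ^ δ * D ≤ C * (C * D)⁻¹ * D := by gcongr
      _ = 1 := by field_simp
  set M : ℝ := (C * 2 ^ ((n : ℝ) - 2)) ^ δ⁻¹
  have hM0 : 0 < M := by positivity
  refine ⟨max t⁻¹ (4 * max 1 M), le_max_of_le_right (by linarith [le_max_left 1 M]),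
    fun x y hxy => ?_⟩
  have hne : (critSet n V x).Nonempty ∨ critRho n V x = 0 := by
    rcases (critSet n V x).eq_empty_or_nonempty with h | h
    · exact Or.inr (by rw [critRho, h, Real.sSup_empty])
    · exact Or.inl h
  rcases hne with hne | h0
  swap
  · have : y = x := (dist_le_zero.1 (hxy.trans h0.le)).symm
    subst this
    simp [h0]
  obtain ⟨r₀, hr₀⟩ := hne
  have hr : 0 < critRho n V x := hr₀.1.trans_le (le_csSup (hbdd x) hr₀)
  obtain ⟨r₁, hr₁, hlt⟩ := exists_lt_of_lt_csSup ⟨r₀, hr₀⟩ (half_lt_self hr)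
  have hle₁ : r₁ ≤ critRho n V x := le_csSup (hbdd x) hr₁
  change critRho n V x / 2 < r₁ at hlt
  set r := critRho n V x
  have hcancel : ∀ s : ℝ, 0 < s → s ^ ((2 : ℝ) - n) * s ^ ((n : ℝ) - 2) = 1 := fun s hs => by
    rw [← Real.rpow_add hs]; simp
  constructor
  · have hmem : t * r ∈ critSet n V y := by
      refine ⟨by positivity, ?_⟩
      have hmass₁ : ∫ z in ball x r₁, V z ≤ r ^ ((n : ℝ) - 2) := by
        calc _ = r₁ ^ ((n : ℝ) - 2) * (r₁ ^ ((2 : ℝ) - n) * ∫ z in ball x r₁, V z) := by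
              rw [← mul_assoc, mul_comm (r₁ ^ _), hcancel r₁ hr₁.1, one_mul]
          _ ≤ r₁ ^ ((n : ℝ) - 2) := mul_le_of_le_one_right (Real.rpow_nonneg hr₁.1.le _) hr₁.2
          _ ≤ r ^ ((n : ℝ) - 2) := Real.rpow_le_rpow hr₁.1.le hle₁ (by linarith)
      have hmass : ∫ z in ball y r, V z ≤ D * r ^ ((n : ℝ) - 2) := by
        calc _ ≤ ∫ z in ball x (2 * r), V z :=
              hV.setIntegral_mono_of_subset_ball hq1
                (ball_subset_ball' (by rw [dist_comm]; linarith))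
          _ ≤ D * ∫ z in ball x (1 / 4 * (2 * r)), V z := hdoub x _ (by positivity)
          _ ≤ D * ∫ z in ball x r₁, V z :=
              mul_le_mul_of_nonneg_left (hV.setIntegral_mono_of_subset_ball hq1
                (ball_subset_ball (by linarith))) hD.le
          _ ≤ _ := by gcongr
      calc _ ≤ C * (t * r / r) ^ δ * (r ^ ((2 : ℝ) - n) * ∫ z in ball y r, V z) :=
            hgrow y (t * r) r (by positivity) (mul_le_of_le_one_left hr.le (min_le_left _ _))
        _ ≤ C * (t * r / r) ^ δ * (r ^ ((2 : ℝ) - n) * (D * r ^ ((n : ℝ) - 2))) := by gcongr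
        _ = C * t ^ δ * D * (r ^ ((2 : ℝ) - n) * r ^ ((n : ℝ) - 2)) := by
            rw [mul_div_cancel_right₀ _ hr.ne']; ring
        _ ≤ 1 := by rw [hcancel r hr, mul_one]; exact htδ
    refine le_trans ?_ (le_csSup (hbdd y) hmem)
    gcongr
    exact inv_le_of_inv_le₀ ht0 (le_max_left _ _)
  · suffices h : critRho n V y ≤ 4 * max 1 M * r from
      h.trans (by gcongr; exact le_max_right _ _)
    refine Real.sSup_le (fun s hs => ?_) (by positivity)
    rcases le_total s (4 * r) with hsr | hsr
    · exact hsr.trans (by gcongr; linarith [le_max_left 1 M])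
    have hs0 : 0 < s := hs.1
    have hgt : 1 < (2 * r) ^ ((2 : ℝ) - n) * ∫ z in ball x (2 * r), V z := by
      by_contra! hcon
      have : 2 * r ≤ r := le_csSup (hbdd x) ⟨by positivity, hcon⟩
      linarith
    have hφ : (s / 2) ^ ((2 : ℝ) - n) * ∫ z in ball x (s / 2), V z ≤ 2 ^ ((n : ℝ) - 2) := by
      calc _ ≤ (s / 2) ^ ((2 : ℝ) - n) * ∫ z in ball y s, V z :=
            mul_le_mul_of_nonneg_left (hV.setIntegral_mono_of_subset_ball hq1
              (ball_subset_ball' (by linarith))) (by positivity)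
        _ = 2 ^ ((n : ℝ) - 2) * (s ^ ((2 : ℝ) - n) * ∫ z in ball y s, V z) := by
            rw [Real.div_rpow hs0.le two_pos.le, ← neg_sub (n : ℝ) 2,
              Real.rpow_neg two_pos.le]
            field_simp
        _ ≤ _ := mul_le_of_le_one_right (by positivity) hs.2
    have h1 : 1 ≤ C * (2 * r / (s / 2)) ^ δ * 2 ^ ((n : ℝ) - 2) := by
      refine hgt.le.trans ((hgrow x (2 * r) (s / 2) (by positivity) (by linarith)).trans ?_)
      gcongr
    have h2 : (s / (4 * r)) ^ δ ≤ C * 2 ^ ((n : ℝ) - 2) := by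
      have hinv : 2 * r / (s / 2) = (s / (4 * r))⁻¹ := by field_simp; norm_num
      rw [hinv, Real.inv_rpow (by positivity)] at h1
      have hp : 0 < (s / (4 * r)) ^ δ := by positivity
      calc _ ≤ (s / (4 * r)) ^ δ * (C * ((s / (4 * r)) ^ δ)⁻¹ * 2 ^ ((n : ℝ) - 2)) :=
            le_mul_of_one_le_right hp.le h1
        _ = _ := by field_simp
    have h3 := (Real.le_rpow_inv_iff_of_pos (by positivity) (by positivity) hδ).2 h2
    rw [div_le_iff₀ (by positivity)] at h3
    calc s ≤ M * (4 * r) := h3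
      _ ≤ max 1 M * (4 * r) := by gcongr; exact le_max_right _ _
      _ = _ := by ring
end
end

section
/- Let n ≥ 3 and let V ∈ B_q for some q ≥ n/2 be nonnegative and not almost everywhere zero, with critical radius function ρ. There exists a constant C > 0 such that for every f ∈ BMO_L(ℝⁿ) and every cube Q with center x_Q and sidelength ℓ(Q) < ρ(x_Q), the average of f over the doubled cube 2Q (the cube concentric with Q of sidelength 2ℓ(Q)) satisfies |f_{2Q}| ≤ C (1 + log(ρ(x_Q)/ℓ(Q))) ‖f‖_{BMO_L}. -/
open MeasureTheory Metric Real

noncomputable section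

/-- The average of `f` over the cube with center `x` and sidelength `l`
(whose Lebesgue measure is `l^n`). -/
def cubeAvg (n : ℕ) (f : Rn n → ℝ) (x : Rn n) (l : ℝ) : ℝ :=
  (1 / l ^ n) * ∫ y in cube n x l, f y

/-- `f` satisfies the `BMO_L` bounds with constant `N`: mean oscillation at most `N` on
every cube, and average of `|f|` at most `N` on every cube whose sidelength is at least
the critical radius of its center. -/
def IsBMOLBound (n : ℕ) (V : Rn n → ℝ) (f : Rn n → ℝ) (N : ℝ) : Prop :=
  (∀ (x : Rn n) (l : ℝ), 0 < l →
    (1 / l ^ n) * (∫ y in cube n x l, |f y - cubeAvg n f x l|) ≤ N) ∧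
  (∀ (x : Rn n) (l : ℝ), 0 < l → critRho n V x ≤ l →
    (1 / l ^ n) * (∫ y in cube n x l, |f y|) ≤ N)

theorem cube_eq_preimage (n : ℕ) (x : Rn n) (l : ℝ) :
    cube n x l = (MeasurableEquiv.toLp 2 (Fin n → ℝ)).symm ⁻¹'
      Set.Icc (fun i => x i - l / 2) (fun i => x i + l / 2) := by
  ext y
  simp only [cube, Set.mem_ofPred_eq, Set.mem_preimage, Set.mem_Icc, Pi.le_def,
    ← forall_and, MeasurableEquiv.coe_toLp_symm]
  refine forall_congr' fun i => ?_
  rw [abs_le]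
  constructor <;> rintro ⟨h₁, h₂⟩ <;> constructor <;> linarith

theorem volume_real_cube (n : ℕ) (x : Rn n) {l : ℝ} (hl : 0 ≤ l) :
    volume.real (cube n x l) = l ^ n := by
  rw [cube_eq_preimage, Measure.real, (EuclideanSpace.volume_preserving_symm_measurableEquiv_toLp
    (Fin n)).measure_preimage_equiv, Real.volume_Icc_pi_toReal]
  · simp
  · intro i
    simp only
    linarith

theorem isCompact_cube (n : ℕ) (x : Rn n) (l : ℝ) : IsCompact (cube n x l) := by
  rw [cube_eq_preimage]
  exact (PiLp.homeomorph 2 (fun _ : Fin n => ℝ)).isCompact_preimage.2 isCompact_Icc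

theorem cube_subset_cube (n : ℕ) (x : Rn n) {l l' : ℝ} (h : l ≤ l') :
    cube n x l ⊆ cube n x l' :=
  fun _ hy i => (hy i).trans (by linarith)

theorem abs_cubeAvg_le (n : ℕ) (f : Rn n → ℝ) (x : Rn n) {l : ℝ} (hl : 0 < l) :
    |cubeAvg n f x l| ≤ (1 / l ^ n) * ∫ y in cube n x l, |f y| := by
  rw [cubeAvg, abs_mul, abs_of_pos (by positivity : 0 < 1 / l ^ n)]
  gcongr
  exact abs_integral_le_integral_abs

theorem cubeAvg_sub_const {n : ℕ} {f : Rn n → ℝ} (hf : LocallyIntegrable f volume)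
    (x : Rn n) {l : ℝ} (hl : 0 < l) (c : ℝ) :
    cubeAvg n (fun y => f y - c) x l = cubeAvg n f x l - c := by
  have hc : IntegrableOn (fun _ : Rn n => c) (cube n x l) volume :=
    integrableOn_const (isCompact_cube n x l).measure_lt_top.ne
  rw [cubeAvg, cubeAvg, integral_sub (hf.integrableOn_isCompact (isCompact_cube n x l)) hc,
    setIntegral_const, volume_real_cube n x hl.le, smul_eq_mul]
  field_simp

/-- Averages over a cube and its double differ by at most `2 ^ n` times the mean oscillation. -/
theorem abs_cubeAvg_sub_cubeAvg_two_mul_le {n : ℕ} {f : Rn n → ℝ}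
    (hf : LocallyIntegrable f volume) (x : Rn n) {l : ℝ} (hl : 0 < l) :
    |cubeAvg n f x l - cubeAvg n f x (2 * l)| ≤
      2 ^ n * ((1 / (2 * l) ^ n) *
        ∫ y in cube n x (2 * l), |f y - cubeAvg n f x (2 * l)|) := by
  set c := cubeAvg n f x (2 * l)
  have hint : IntegrableOn (fun y => |f y - c|) (cube n x (2 * l)) volume :=
    ((hf.integrableOn_isCompact (isCompact_cube n x _)).sub
      (integrableOn_const (isCompact_cube n x _).measure_lt_top.ne)).abs
  rw [← cubeAvg_sub_const hf x hl c]
  refine (abs_cubeAvg_le n _ x hl).trans ?_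
  calc (1 / l ^ n) * ∫ y in cube n x l, |f y - c|
      ≤ (1 / l ^ n) * ∫ y in cube n x (2 * l), |f y - c| := by
        refine mul_le_mul_of_nonneg_left ?_ (by positivity)
        exact setIntegral_mono_set hint (Filter.Eventually.of_forall fun _ => abs_nonneg _)
          (cube_subset_cube n x (by linarith)).eventuallyLE
    _ = _ := by
        rw [mul_pow]
        field_simp

/-- If `m` doublings take a cube past the critical radius, its average is at most
`(1 + m * 2 ^ n) * N`. -/
theorem IsBMOLBound.abs_cubeAvg_le_of_critRho_le {n : ℕ} {V f : Rn n → ℝ} {N : ℝ}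
    (h : IsBMOLBound n V f N) (hf : LocallyIntegrable f volume) (x : Rn n) (m : ℕ) {l : ℝ}
    (hl : 0 < l) (hm : critRho n V x ≤ 2 ^ m * l) :
    |cubeAvg n f x l| ≤ (1 + m * 2 ^ n) * N := by
  induction m generalizing l with
  | zero => simpa using (abs_cubeAvg_le n f x hl).trans (h.2 x l hl (by simpa using hm))
  | succ m ih =>
    have h₁ := ih (l := 2 * l) (by positivity) (hm.trans_eq (by ring))
    have h₂ := (abs_cubeAvg_sub_cubeAvg_two_mul_le hf x hl).trans
      (mul_le_mul_of_nonneg_left (h.1 x (2 * l) (by positivity)) (by positivity))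
    have h₃ := abs_sub_abs_le_abs_sub (cubeAvg n f x l) (cubeAvg n f x (2 * l))
    push_cast
    linarith

/-- For `f ∈ BMO_L` and a cube `Q` with center `x` and sidelength `l < ρ(x)`, the average
of `f` over the doubled cube `2Q` satisfies
`|f_{2Q}| ≤ C (1 + log(ρ(x)/l)) ‖f‖_{BMO_L}`. -/
theorem avg_doubled_cube_log_bound (n : ℕ) (hn : 3 ≤ n) (V : Rn n → ℝ) (q : ℝ)
    (hq : (n : ℝ) / 2 ≤ q) (hV : IsReverseHolder n V q)
    (hV0 : ¬ V =ᵐ[(volume : Measure (Rn n))] 0) :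
    ∃ C > 0, ∀ f : Rn n → ℝ, LocallyIntegrable f volume →
      ∀ N : ℝ, 0 ≤ N → IsBMOLBound n V f N →
      ∀ (x : Rn n) (l : ℝ), 0 < l → l < critRho n V x →
        |cubeAvg n f x (2 * l)| ≤ C * (1 + Real.log (critRho n V x / l)) * N := by
  refine ⟨2 ^ (n + 1), by positivity, fun f hf N hN h x l hl hlρ => ?_⟩
  obtain ⟨m, hm₁, hm₂⟩ := exists_nat_pow_near ((one_lt_div hl).2 hlρ).le one_lt_two
  refine (h.abs_cubeAvg_le_of_critRho_le hf x m (by positivity) ?_).trans ?_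
  · rw [div_lt_iff₀ hl, pow_succ, mul_assoc] at hm₂
    exact hm₂.le
  · have hlog : m * Real.log 2 ≤ Real.log (critRho n V x / l) := by
      rw [← Real.log_pow]
      exact Real.log_le_log (by positivity) hm₁
    have hm : (m : ℝ) ≤ 2 * Real.log (critRho n V x / l) := by
      nlinarith [Real.log_two_gt_d9, (Nat.cast_nonneg m : (0 : ℝ) ≤ m)]
    have hn₁ : (1 : ℝ) ≤ 2 ^ n := one_le_pow₀ one_le_two
    gcongr
    rw [pow_succ]
    nlinarith
end
end

section
/- Let n ≥ 3 and let V ∈ B_q for some q ≥ n/2 be nonnegative and not almost everywhere zero, with critical radius function ρ. For every p ∈ [1, ∞) there exists a constant C = C(p, n, V) > 0 such that for every f ∈ BMO_L(ℝⁿ) and every cube Q ⊂ ℝⁿ with sides parallel to the axes, ( (1/|Q|) ∫_Q |f(x) − f_Q|^p dx )^{1/p} ≤ C ‖f‖_{BMO_L}, where f_Q = (1/|Q|) ∫_Q f. -/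
open MeasureTheory Metric Real

noncomputable section

open Set Filter Topology
open scoped ENNReal

section DyadicCubes

variable {ι : Type*}

/-- The center of the dyadic child, labelled by `s`, of the cube with center `x` and
half-side `r`. -/
def childCenter (x : ι → ℝ) (r : ℝ) (s : ι → Bool) : ι → ℝ :=
  fun i => x i + (if s i then r / 2 else -(r / 2))

/-- The label of the orthant at `x` containing `y`. -/
def orthant (x y : ι → ℝ) : ι → Bool :=
  fun i => decide (x i ≤ y i)

lemma measurable_orthant (x : ι → ℝ) : Measurable (orthant x) := by
  refine measurable_pi_lambda _ fun i => ?_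
  refine measurable_to_bool ?_
  have : (fun y => orthant x y i) ⁻¹' {true} = {y | x i ≤ y i} := by
    ext y; simp [orthant]
  rw [this]
  exact measurableSet_le measurable_const (measurable_pi_apply i)

variable [Fintype ι]

lemma mem_closedBall_iff_abs {x y : ι → ℝ} {r : ℝ} (hr : 0 ≤ r) :
    y ∈ closedBall x r ↔ ∀ i, |y i - x i| ≤ r := by
  simp [mem_closedBall, dist_pi_le_iff hr, Real.dist_eq]

lemma mem_closedBall_childCenter_orthant {x y : ι → ℝ} {r : ℝ} (hr : 0 ≤ r)
    (hy : y ∈ closedBall x r) :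
    y ∈ closedBall (childCenter x r (orthant x y)) (r / 2) := by
  rw [mem_closedBall_iff_abs hr] at hy
  rw [mem_closedBall_iff_abs (by positivity)]
  intro i
  have := abs_le.1 (hy i)
  by_cases h : x i ≤ y i <;> simp only [childCenter, orthant, h, decide_true, decide_false,
    if_true, Bool.false_eq_true, if_false] <;> rw [abs_le] <;> constructor <;> linarith

lemma closedBall_childCenter_subset {x : ι → ℝ} {r : ℝ} (hr : 0 ≤ r) (s : ι → Bool) :
    closedBall (childCenter x r s) (r / 2) ⊆ closedBall x r := by
  intro y hy
  rw [mem_closedBall_iff_abs (by positivity)] at hy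
  rw [mem_closedBall_iff_abs hr]
  intro i
  have := abs_le.1 (hy i)
  cases h : s i <;> simp only [childCenter, h, if_true, Bool.false_eq_true, if_false] at this <;>
    rw [abs_le] <;> constructor <;> linarith

lemma closedBall_eq_iUnion_childCenter (x : ι → ℝ) {r : ℝ} (hr : 0 ≤ r) :
    closedBall x r = ⋃ s, closedBall (childCenter x r s) (r / 2) := by
  refine Subset.antisymm (fun y hy => mem_iUnion.2 ⟨orthant x y, ?_⟩)
    (iUnion_subset fun s => closedBall_childCenter_subset hr s)
  exact mem_closedBall_childCenter_orthant hr hy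

lemma orthant_eq_of_mem_closedBall {x y : ι → ℝ} {r : ℝ} (hr : 0 ≤ r) {s : ι → Bool}
    (hy : y ∈ closedBall (childCenter x r s) (r / 2)) (hne : ∀ i, y i ≠ x i) :
    orthant x y = s := by
  rw [mem_closedBall_iff_abs (by positivity)] at hy
  funext i
  have := abs_le.1 (hy i)
  cases h : s i <;> simp only [childCenter, h, if_true, Bool.false_eq_true, if_false] at this
  · simp only [orthant, decide_eq_false_iff_not, not_le]
    exact lt_of_le_of_ne (by linarith) (hne i)
  · simp only [orthant, decide_eq_true_eq]
    linarith

lemma ae_forall_apply_ne (x : ι → ℝ) : ∀ᵐ y : ι → ℝ, ∀ i, y i ≠ x i :=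
  ae_all_iff.2 fun i => Measure.ae_eval_ne (α := fun _ => ℝ) (fun _ => volume) i (x i)

lemma aedisjoint_closedBall_childCenter (x : ι → ℝ) {r : ℝ} (hr : 0 ≤ r) :
    Pairwise (Function.onFun (AEDisjoint volume)
      fun s => closedBall (childCenter x r s) (r / 2)) := by
  intro s t hst
  refine measure_mono_null ?_ (ae_iff.1 (ae_forall_apply_ne x))
  rintro y ⟨hs, ht⟩ hne
  exact hst ((orthant_eq_of_mem_closedBall hr hs hne).symm.trans
    (orthant_eq_of_mem_closedBall hr ht hne))

lemma lintegral_closedBall_eq_sum_childCenter [DecidableEq ι] (x : ι → ℝ) {r : ℝ} (hr : 0 ≤ r)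
    (g : (ι → ℝ) → ℝ≥0∞) :
    ∫⁻ y in closedBall x r, g y = ∑ s, ∫⁻ y in closedBall (childCenter x r s) (r / 2), g y := by
  rw [closedBall_eq_iUnion_childCenter x hr,
    lintegral_iUnion₀ (fun s => measurableSet_closedBall.nullMeasurableSet)
      (aedisjoint_closedBall_childCenter x hr), tsum_fintype]

lemma volume_closedBall_eq_sum_childCenter [DecidableEq ι] (x : ι → ℝ) {r : ℝ} (hr : 0 ≤ r) :
    volume (closedBall x r) = ∑ s, volume (closedBall (childCenter x r s) (r / 2)) := by
  simpa using lintegral_closedBall_eq_sum_childCenter x hr 1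

lemma volume_closedBall_eq_two_pow_mul (x y : ι → ℝ) {r : ℝ} (hr : 0 ≤ r) :
    volume (closedBall x r) = 2 ^ Fintype.card ι * volume (closedBall y (r / 2)) := by
  rw [Real.volume_pi_closedBall x hr, Real.volume_pi_closedBall y (by positivity),
    show (2 * r) ^ Fintype.card ι = 2 ^ Fintype.card ι * (2 * (r / 2)) ^ Fintype.card ι by
      rw [← mul_pow]; ring, ENNReal.ofReal_mul (by positivity), ENNReal.ofReal_pow (by simp)]
  simp

/-- The average of `f` over the level `m` dyadic subcube containing `y` of the cube with
center `x` and half-side `r`. -/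
def dyadicAvg (f : (ι → ℝ) → ℝ) : ℕ → (ι → ℝ) → ℝ → (ι → ℝ) → ℝ
  | 0, x, r, _ => ⨍ z in closedBall x r, f z
  | m + 1, x, r, y => dyadicAvg f m (childCenter x r (orthant x y)) (r / 2) y

lemma measurable_dyadicAvg (f : (ι → ℝ) → ℝ) (m : ℕ) :
    ∀ x r, Measurable (dyadicAvg f m x r) := by
  induction m with
  | zero => exact fun x r => measurable_const
  | succ m ih =>
    intro x r
    have h : Measurable fun p : (ι → ℝ) × (ι → Bool) =>
        dyadicAvg f m (childCenter x r p.2) (r / 2) p.1 :=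
      measurable_from_prod_countable_left fun s => ih (childCenter x r s) (r / 2)
    exact h.comp (measurable_id.prodMk (measurable_orthant x))

lemma exists_dyadicAvg_eq_average (f : (ι → ℝ) → ℝ) (m : ℕ) :
    ∀ (x : ι → ℝ) (r : ℝ), 0 ≤ r → ∀ y ∈ closedBall x r, ∃ c : ι → ℝ,
      y ∈ closedBall c (r / 2 ^ m) ∧
        dyadicAvg f m x r y = ⨍ z in closedBall c (r / 2 ^ m), f z := by
  induction m with
  | zero => exact fun x r _ y hy => ⟨x, by simpa using hy, by simp [dyadicAvg]⟩
  | succ m ih =>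
    intro x r hr y hy
    obtain ⟨c, hc, h⟩ := ih _ (r / 2) (by positivity) y (mem_closedBall_childCenter_orthant hr hy)
    rw [show r / 2 / 2 ^ m = r / 2 ^ (m + 1) by rw [pow_succ]; field_simp] at hc h
    exact ⟨c, hc, h⟩

lemma ae_tendsto_dyadicAvg {f : (ι → ℝ) → ℝ} (hf : LocallyIntegrable f) (x : ι → ℝ) {r : ℝ}
    (hr : 0 < r) :
    ∀ᵐ y, y ∈ closedBall x r → Tendsto (fun m => dyadicAvg f m x r y) atTop (𝓝 (f y)) := by
  filter_upwards [IsUnifLocDoublingMeasure.ae_tendsto_average volume hf 1] with y hy hyx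
  choose c hc h using fun m => exists_dyadicAvg_eq_average f m x r hr.le y hyx
  simp only [h]
  refine hy c _ (tendsto_nhdsWithin_iff.2 ⟨?_, Eventually.of_forall fun m => ?_⟩)
    (Eventually.of_forall fun m => by simpa using hc m)
  · have := (tendsto_pow_atTop_nhds_zero_of_lt_one (r := (1 / 2 : ℝ)) (by norm_num)
      (by norm_num)).const_mul r
    simpa [div_eq_mul_inv] using this
  · exact mem_Ioi.2 (by positivity)

lemma lintegral_dyadicAvg_succ [DecidableEq ι] (f : (ι → ℝ) → ℝ) (m : ℕ) (x : ι → ℝ) {r : ℝ} (hr : 0 ≤ r)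
    (φ : ℝ → ℝ≥0∞) :
    ∫⁻ y in closedBall x r, φ (dyadicAvg f (m + 1) x r y) =
      ∑ s, ∫⁻ y in closedBall (childCenter x r s) (r / 2),
        φ (dyadicAvg f m (childCenter x r s) (r / 2) y) := by
  rw [lintegral_closedBall_eq_sum_childCenter x hr]
  refine Finset.sum_congr rfl fun s _ => setLIntegral_congr_fun_ae measurableSet_closedBall ?_
  filter_upwards [ae_forall_apply_ne x] with y hne hy
  rw [dyadicAvg, orthant_eq_of_mem_closedBall hr hy hne]

lemma ofReal_abs_average_sub_mul_le {f : (ι → ℝ) → ℝ} (hf : LocallyIntegrable f) (x : ι → ℝ)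
    {r : ℝ} (hr : 0 < r) (a : ℝ) :
    ENNReal.ofReal |(⨍ z in closedBall x r, f z) - a| * volume (closedBall x r) ≤
      ∫⁻ y in closedBall x r, ‖f y - a‖ₑ := by
  have hfin : volume (closedBall x r) ≠ ∞ := measure_closedBall_lt_top.ne
  have hpos : 0 < (volume (closedBall x r)).toReal :=
    ENNReal.toReal_pos (measure_closedBall_pos volume x hr).ne' hfin
  have hint : IntegrableOn f (closedBall x r) :=
    hf.integrableOn_isCompact (isCompact_closedBall x r)
  have h : ∫ y in closedBall x r, (f y - a) =
      (volume (closedBall x r)).toReal * ((⨍ z in closedBall x r, f z) - a) := by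
    rw [integral_sub hint (integrableOn_const hfin), setAverage_eq]
    simp only [integral_const, measureReal_def, Measure.restrict_apply_univ, smul_eq_mul]
    field_simp
  calc _ = ‖∫ y in closedBall x r, (f y - a)‖ₑ := by
        rw [h, enorm_mul, Real.enorm_eq_ofReal_abs, Real.enorm_eq_ofReal_abs, abs_of_pos hpos,
          ENNReal.ofReal_toReal hfin, mul_comm]
    _ ≤ _ := enorm_integral_le_lintegral_enorm _

lemma abs_average_childCenter_sub_le {f : (ι → ℝ) → ℝ} (hf : LocallyIntegrable f) {N : ℝ}
    (hN : 0 ≤ N) {x : ι → ℝ} {r : ℝ} (hr : 0 < r)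
    (h : ∫⁻ y in closedBall x r, ‖f y - ⨍ z in closedBall x r, f z‖ₑ ≤
      ENNReal.ofReal N * volume (closedBall x r)) (s : ι → Bool) :
    |(⨍ z in closedBall (childCenter x r s) (r / 2), f z) - ⨍ z in closedBall x r, f z| ≤
      2 ^ Fintype.card ι * N := by
  have h1 := ((ofReal_abs_average_sub_mul_le hf (childCenter x r s) (half_pos hr)
    (⨍ z in closedBall x r, f z)).trans
    (lintegral_mono_set (closedBall_childCenter_subset hr.le s))).trans h
  rw [volume_closedBall_eq_two_pow_mul x (childCenter x r s) hr.le, ← mul_assoc] at h1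
  have h2 := (ENNReal.mul_le_mul_iff_left (measure_closedBall_pos volume _ (half_pos hr)).ne'
    measure_closedBall_lt_top.ne).1 h1
  rw [show (2 : ℝ≥0∞) = ENNReal.ofReal 2 by simp, ← ENNReal.ofReal_pow (by norm_num),
    ← ENNReal.ofReal_mul hN, ENNReal.ofReal_le_ofReal_iff (by positivity)] at h2
  linarith

/-- The exponential rate in the John–Nirenberg inequality for mean oscillation `N` in
dimension `d`. -/
def johnNirenbergRate (d : ℕ) (N : ℝ) : ℝ :=
  Real.log (3 / 2) / ((2 + 2 ^ d) * N)

lemma johnNirenbergRate_pos (d : ℕ) {N : ℝ} (hN : 0 < N) : 0 < johnNirenbergRate d N :=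
  div_pos (Real.log_pos (by norm_num)) (by positivity)

lemma exp_johnNirenbergRate_mul_le (d : ℕ) {N t : ℝ} (hN : 0 < N) (ht : t ≤ (2 + 2 ^ d) * N) :
    Real.exp (johnNirenbergRate d N * t) ≤ 3 / 2 := by
  have h : johnNirenbergRate d N * t ≤ Real.log (3 / 2) := by
    refine (mul_le_mul_of_nonneg_left ht (johnNirenbergRate_pos d hN).le).trans_eq ?_
    have : (0 : ℝ) < (2 + 2 ^ d) * N := by positivity
    rw [johnNirenbergRate, div_mul_cancel₀ _ this.ne']
  exact (Real.exp_le_exp.2 h).trans_eq (Real.exp_log (by norm_num))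

/-- The exponential moment about `a` of the level `m` dyadic averages of `f` on the cube
with center `x` and half-side `r`. -/
def dyadicExpMoment (f : (ι → ℝ) → ℝ) (c : ℝ) (m : ℕ) (a : ℝ) (x : ι → ℝ) (r : ℝ) : ℝ≥0∞ :=
  ∫⁻ y in closedBall x r, ENNReal.ofReal (Real.exp (c * |dyadicAvg f m x r y - a|))

lemma dyadicExpMoment_le_mul (f : (ι → ℝ) → ℝ) {c : ℝ} (hc : 0 ≤ c) (m : ℕ) (a b : ℝ)
    (x : ι → ℝ) (r : ℝ) :
    dyadicExpMoment f c m a x r ≤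
      ENNReal.ofReal (Real.exp (c * |b - a|)) * dyadicExpMoment f c m b x r := by
  rw [dyadicExpMoment, dyadicExpMoment, ← lintegral_const_mul' _ _ ENNReal.ofReal_ne_top]
  refine lintegral_mono fun y => ?_
  rw [← ENNReal.ofReal_mul (Real.exp_pos _).le, ← Real.exp_add, ← mul_add]
  gcongr
  rw [add_comm]
  exact abs_sub_le _ _ _

/-- The dyadic exponential moment about a value `a` within `A` of the average is controlled by
the mean oscillation about `a`. -/
def DyadicMomentBound (f : (ι → ℝ) → ℝ) (N : ℝ) (m : ℕ) (A : ℝ) : Prop :=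
  ∀ (x : ι → ℝ) (r : ℝ), 0 < r → ∀ a, |(⨍ z in closedBall x r, f z) - a| ≤ A →
    dyadicExpMoment f (johnNirenbergRate (Fintype.card ι) N) m a x r ≤
      ENNReal.ofReal (3 / 2) * volume (closedBall x r) +
        ENNReal.ofReal (9 / (2 * N)) * ∫⁻ y in closedBall x r, ‖f y - a‖ₑ

variable {f : (ι → ℝ) → ℝ} {N : ℝ}

lemma dyadicMomentBound_zero (hN : 0 < N) : DyadicMomentBound f N 0 (2 * N) := by
  intro x r hr a ha
  refine le_trans ?_ le_self_add
  simp only [dyadicExpMoment, dyadicAvg, setLIntegral_const]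
  gcongr
  refine exp_johnNirenbergRate_mul_le _ hN (ha.trans ?_)
  gcongr
  simp

lemma DyadicMomentBound.moment_le (hN : 0 < N)
    (hosc : ∀ (x : ι → ℝ) (r : ℝ), 0 < r →
      ∫⁻ y in closedBall x r, ‖f y - ⨍ z in closedBall x r, f z‖ₑ ≤
        ENNReal.ofReal N * volume (closedBall x r))
    {m : ℕ} (h : DyadicMomentBound f N m (2 * N)) (x : ι → ℝ) {r : ℝ} (hr : 0 < r) :
    dyadicExpMoment f (johnNirenbergRate (Fintype.card ι) N) m (⨍ z in closedBall x r, f z) x r ≤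
      ENNReal.ofReal 6 * volume (closedBall x r) := by
  refine (h x r hr _ (by simpa using hN.le)).trans ?_
  calc _ ≤ ENNReal.ofReal (3 / 2) * volume (closedBall x r) + ENNReal.ofReal (9 / (2 * N)) *
        (ENNReal.ofReal N * volume (closedBall x r)) := by gcongr; exact hosc x r hr
    _ = _ := by
      rw [← mul_assoc, ← ENNReal.ofReal_mul (by positivity), ← add_mul,
        ← ENNReal.ofReal_add (by norm_num) (by positivity)]
      congr 2
      field_simp
      norm_num

lemma DyadicMomentBound.extend (hf : LocallyIntegrable f) (hN : 0 < N)
    (hosc : ∀ (x : ι → ℝ) (r : ℝ), 0 < r →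
      ∫⁻ y in closedBall x r, ‖f y - ⨍ z in closedBall x r, f z‖ₑ ≤
        ENNReal.ofReal N * volume (closedBall x r))
    {m : ℕ} (h : DyadicMomentBound f N m (2 * N)) :
    DyadicMomentBound f N m ((2 + 2 ^ Fintype.card ι) * N) := by
  intro x r hr a ha
  by_cases hlt : |(⨍ z in closedBall x r, f z) - a| ≤ 2 * N
  · exact h x r hr a hlt
  push Not at hlt
  refine le_trans ?_ le_add_self
  calc _ ≤ _ := dyadicExpMoment_le_mul f (johnNirenbergRate_pos _ hN).le m a
        (⨍ z in closedBall x r, f z) x r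
    _ ≤ ENNReal.ofReal (3 / 2) * (ENNReal.ofReal 6 * volume (closedBall x r)) := by
        gcongr
        · exact exp_johnNirenbergRate_mul_le _ hN ha
        · exact h.moment_le hN hosc x hr
    _ = ENNReal.ofReal (9 / (2 * N)) * (ENNReal.ofReal (2 * N) * volume (closedBall x r)) := by
        rw [← mul_assoc, ← mul_assoc, ← ENNReal.ofReal_mul (by positivity),
          ← ENNReal.ofReal_mul (by positivity)]
        congr 2
        field_simp
        norm_num
    _ ≤ _ := by
        gcongr
        refine le_trans ?_ (ofReal_abs_average_sub_mul_le hf x hr a)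
        gcongr

lemma DyadicMomentBound.succ (hf : LocallyIntegrable f) (hN : 0 < N)
    (hosc : ∀ (x : ι → ℝ) (r : ℝ), 0 < r →
      ∫⁻ y in closedBall x r, ‖f y - ⨍ z in closedBall x r, f z‖ₑ ≤
        ENNReal.ofReal N * volume (closedBall x r))
    {m : ℕ} (h : DyadicMomentBound f N m ((2 + 2 ^ Fintype.card ι) * N)) :
    DyadicMomentBound f N (m + 1) (2 * N) := by
  classical
  intro x r hr a ha
  rw [dyadicExpMoment, lintegral_dyadicAvg_succ f m x hr.le
      (fun t => ENNReal.ofReal (Real.exp (johnNirenbergRate (Fintype.card ι) N * |t - a|))),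
    lintegral_closedBall_eq_sum_childCenter x hr.le, volume_closedBall_eq_sum_childCenter x hr.le,
    Finset.mul_sum, Finset.mul_sum, ← Finset.sum_add_distrib]
  refine Finset.sum_le_sum fun s _ => h _ _ (half_pos hr) a ?_
  have h1 := abs_average_childCenter_sub_le hf hN.le hr (hosc x r hr) s
  have h2 := abs_sub_le (⨍ z in closedBall (childCenter x r s) (r / 2), f z)
    (⨍ z in closedBall x r, f z) a
  linarith

lemma dyadicMomentBound (hf : LocallyIntegrable f) (hN : 0 < N)
    (hosc : ∀ (x : ι → ℝ) (r : ℝ), 0 < r →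
      ∫⁻ y in closedBall x r, ‖f y - ⨍ z in closedBall x r, f z‖ₑ ≤
        ENNReal.ofReal N * volume (closedBall x r)) (m : ℕ) :
    DyadicMomentBound f N m (2 * N) := by
  induction m with
  | zero => exact dyadicMomentBound_zero hN
  | succ m ih => exact (ih.extend hf hN hosc).succ hf hN hosc

/-- **John–Nirenberg inequality** in exponential form, on cubes. -/
theorem lintegral_exp_oscillation_le (hf : LocallyIntegrable f) (hN : 0 < N)
    (hosc : ∀ (x : ι → ℝ) (r : ℝ), 0 < r →
      ∫⁻ y in closedBall x r, ‖f y - ⨍ z in closedBall x r, f z‖ₑ ≤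
        ENNReal.ofReal N * volume (closedBall x r)) (x : ι → ℝ) {r : ℝ} (hr : 0 < r) :
    ∫⁻ y in closedBall x r, ENNReal.ofReal (Real.exp (johnNirenbergRate (Fintype.card ι) N *
        |f y - ⨍ z in closedBall x r, f z|)) ≤
      ENNReal.ofReal 6 * volume (closedBall x r) := by
  set c := johnNirenbergRate (Fintype.card ι) N
  set a := ⨍ z in closedBall x r, f z
  have hcont : Continuous fun t : ℝ => ENNReal.ofReal (Real.exp (c * |t - a|)) :=
    ENNReal.continuous_ofReal.comp (by fun_prop)
  calc _ = ∫⁻ y in closedBall x r, liminf (fun m =>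
        ENNReal.ofReal (Real.exp (c * |dyadicAvg f m x r y - a|))) atTop := by
        refine setLIntegral_congr_fun_ae measurableSet_closedBall ?_
        filter_upwards [ae_tendsto_dyadicAvg hf x hr] with y hy hyx
        exact ((hcont.tendsto _).comp (hy hyx)).liminf_eq.symm
    _ ≤ liminf (fun m => dyadicExpMoment f c m a x r) atTop :=
        lintegral_liminf_le fun m => hcont.measurable.comp (measurable_dyadicAvg f m x r)
    _ ≤ _ := by
        refine liminf_le_of_frequently_le' (Frequently.of_forall fun m => ?_)
        exact (dyadicMomentBound hf hN hosc m).moment_le hN hosc x hr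

/-- The constant relating the power `p` to the exponential. -/
def rpowExpConst (p : ℝ) : ℝ := 1 + (⌈p⌉₊).factorial

lemma rpowExpConst_pos (p : ℝ) : 0 < rpowExpConst p := by
  unfold rpowExpConst; positivity

lemma rpow_le_rpowExpConst_mul_exp {p u : ℝ} (hp : 0 ≤ p) (hu : 0 ≤ u) :
    u ^ p ≤ rpowExpConst p * Real.exp u := by
  have h1 : (1 : ℝ) ≤ Real.exp u := Real.one_le_exp hu
  have hk := Real.pow_div_factorial_le_exp u hu ⌈p⌉₊
  rw [div_le_iff₀ (by positivity)] at hk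
  rw [rpowExpConst, add_mul, one_mul]
  rcases le_total u 1 with h | h
  · have := Real.rpow_le_one hu h hp
    nlinarith [Real.exp_pos u, (Nat.cast_nonneg (⌈p⌉₊).factorial : (0 : ℝ) ≤ _)]
  · have : u ^ p ≤ u ^ ((⌈p⌉₊ : ℕ) : ℝ) := Real.rpow_le_rpow_of_exponent_le h (Nat.le_ceil p)
    rw [Real.rpow_natCast] at this
    nlinarith

/-- Power form of the John–Nirenberg inequality on cubes. -/
theorem lintegral_rpow_oscillation_le (hf : LocallyIntegrable f) (hN : 0 < N)
    (hosc : ∀ (x : ι → ℝ) (r : ℝ), 0 < r →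
      ∫⁻ y in closedBall x r, ‖f y - ⨍ z in closedBall x r, f z‖ₑ ≤
        ENNReal.ofReal N * volume (closedBall x r)) {p : ℝ} (hp : 0 ≤ p) (x : ι → ℝ) {r : ℝ}
    (hr : 0 < r) :
    ∫⁻ y in closedBall x r, ENNReal.ofReal (|f y - ⨍ z in closedBall x r, f z| ^ p) ≤
      ENNReal.ofReal (6 * rpowExpConst p / johnNirenbergRate (Fintype.card ι) N ^ p *
        (2 * r) ^ Fintype.card ι) := by
  have hc := johnNirenbergRate_pos (Fintype.card ι) hN
  have hK := rpowExpConst_pos p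
  set c := johnNirenbergRate (Fintype.card ι) N
  have hpt : ∀ t : ℝ, |t| ^ p ≤ rpowExpConst p / c ^ p * Real.exp (c * |t|) := fun t => by
    have := rpow_le_rpowExpConst_mul_exp hp (mul_nonneg hc.le (abs_nonneg t))
    rw [Real.mul_rpow hc.le (abs_nonneg t)] at this
    rw [div_mul_eq_mul_div, le_div_iff₀ (by positivity)]
    linarith
  calc _ ≤ ∫⁻ y in closedBall x r, ENNReal.ofReal (rpowExpConst p / c ^ p) *
        ENNReal.ofReal (Real.exp (c * |f y - ⨍ z in closedBall x r, f z|)) := by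
        refine lintegral_mono fun y => ?_
        rw [← ENNReal.ofReal_mul (by positivity)]
        exact ENNReal.ofReal_le_ofReal (hpt _)
    _ ≤ ENNReal.ofReal (rpowExpConst p / c ^ p) *
        (ENNReal.ofReal 6 * volume (closedBall x r)) := by
        rw [lintegral_const_mul' _ _ ENNReal.ofReal_ne_top]
        gcongr
        exact lintegral_exp_oscillation_le hf hN hosc x hr
    _ = _ := by
        rw [Real.volume_pi_closedBall x hr.le, ← ENNReal.ofReal_mul (by norm_num),
          ← ENNReal.ofReal_mul (by positivity)]
        congr 1
        ring

end DyadicCubes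

section Cubes

variable {n : ℕ}

lemma cube_eq_preimage_closedBall (x : Rn n) {l : ℝ} (hl : 0 ≤ l) :
    cube n x l = WithLp.ofLp ⁻¹' closedBall (WithLp.ofLp x) (l / 2) := by
  ext y
  rw [mem_preimage, mem_closedBall_iff_abs (by positivity)]
  rfl

lemma measurableEmbedding_ofLp : MeasurableEmbedding (WithLp.ofLp : Rn n → Fin n → ℝ) :=
  (MeasurableEquiv.toLp 2 (Fin n → ℝ)).symm.measurableEmbedding

lemma lintegral_cube_eq (x : Rn n) {l : ℝ} (hl : 0 ≤ l) (g : Rn n → ℝ≥0∞) :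
    ∫⁻ y in cube n x l, g y =
      ∫⁻ y in closedBall (WithLp.ofLp x) (l / 2), g (WithLp.toLp 2 y) := by
  rw [cube_eq_preimage_closedBall x hl, ← (PiLp.volume_preserving_ofLp
    (Fin n)).setLIntegral_comp_preimage_emb measurableEmbedding_ofLp]

lemma cubeAvg_eq_average (f : Rn n → ℝ) (x : Rn n) {l : ℝ} (hl : 0 ≤ l) :
    cubeAvg n f x l =
      ⨍ y in closedBall (WithLp.ofLp x) (l / 2), f (WithLp.toLp 2 y) := by
  have h : ∫ y in WithLp.ofLp ⁻¹' closedBall (WithLp.ofLp x) (l / 2), f y =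
      ∫ y in closedBall (WithLp.ofLp x) (l / 2), f (WithLp.toLp 2 y) :=
    (PiLp.volume_preserving_ofLp (Fin n)).setIntegral_preimage_emb measurableEmbedding_ofLp
      (fun y => f (WithLp.toLp 2 y)) _
  rw [cubeAvg, cube_eq_preimage_closedBall x hl, h, setAverage_eq, measureReal_def,
    Real.volume_pi_closedBall _ (by positivity), ENNReal.toReal_ofReal (by positivity)]
  simp [mul_div_cancel₀]

lemma locallyIntegrable_comp_toLp {f : Rn n → ℝ} (hf : LocallyIntegrable f) :
    LocallyIntegrable fun y => f (WithLp.toLp 2 y) := by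
  have h := (PiLp.volume_preserving_toLp (Fin n)).map_eq
  rw [← h] at hf
  exact (locallyIntegrable_map_homeomorph
    (PiLp.continuousLinearEquiv 2 ℝ fun _ : Fin n => ℝ).symm.toHomeomorph).1 hf

lemma integrableOn_cube {f : Rn n → ℝ} (hf : LocallyIntegrable f) (x : Rn n) {l : ℝ}
    (hl : 0 ≤ l) : IntegrableOn f (cube n x l) := by
  rw [cube_eq_preimage_closedBall x hl]
  exact hf.integrableOn_isCompact ((PiLp.continuousLinearEquiv 2 ℝ
    fun _ : Fin n => ℝ).toHomeomorph.isCompact_preimage.2 (isCompact_closedBall _ _))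

lemma lintegral_oscillation_le_of_cube {f : Rn n → ℝ} (hf : LocallyIntegrable f) {N : ℝ}
    (hN : 0 ≤ N)
    (hosc : ∀ (x : Rn n) (l : ℝ), 0 < l →
      (1 / l ^ n) * (∫ y in cube n x l, |f y - cubeAvg n f x l|) ≤ N)
    (x : Fin n → ℝ) {r : ℝ} (hr : 0 < r) :
    ∫⁻ y in closedBall x r, ‖f (WithLp.toLp 2 y) -
        ⨍ z in closedBall x r, f (WithLp.toLp 2 z)‖ₑ ≤
      ENNReal.ofReal N * volume (closedBall x r) := by
  have hl : 0 < 2 * r := by positivity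
  have havg := cubeAvg_eq_average f (WithLp.toLp 2 x) hl.le
  have hlint := lintegral_cube_eq (WithLp.toLp 2 x) hl.le
    fun y => ‖f y - cubeAvg n f (WithLp.toLp 2 x) (2 * r)‖ₑ
  have h := hosc (WithLp.toLp 2 x) (2 * r) hl
  simp only [mul_div_cancel_left₀ r (two_ne_zero (α := ℝ))] at havg hlint
  rw [← havg, ← hlint, Real.volume_pi_closedBall x hr.le, Fintype.card_fin,
    ← ENNReal.ofReal_mul hN]
  have hcube := integrableOn_cube hf (WithLp.toLp 2 x) hl.le
  have hvol : volume (cube n (WithLp.toLp 2 x) (2 * r)) ≠ ∞ := by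
    rw [cube_eq_preimage_closedBall _ hl.le, (PiLp.volume_preserving_ofLp
      (Fin n)).measure_preimage measurableSet_closedBall.nullMeasurableSet]
    exact measure_closedBall_lt_top.ne
  have hint : IntegrableOn (fun y => f y - cubeAvg n f (WithLp.toLp 2 x) (2 * r))
      (cube n (WithLp.toLp 2 x) (2 * r)) := hcube.sub (integrableOn_const hvol)
  rw [← ofReal_integral_norm_eq_lintegral_enorm hint]
  refine ENNReal.ofReal_le_ofReal ?_
  rw [one_div, inv_mul_le_iff₀ (by positivity)] at h
  simp only [Real.norm_eq_abs]
  linarith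

theorem lintegral_cube_rpow_oscillation_le {f : Rn n → ℝ} (hf : LocallyIntegrable f) {N : ℝ}
    (hN : 0 < N)
    (hosc : ∀ (x : Rn n) (l : ℝ), 0 < l →
      (1 / l ^ n) * (∫ y in cube n x l, |f y - cubeAvg n f x l|) ≤ N)
    {p : ℝ} (hp : 0 ≤ p) (x : Rn n) {l : ℝ} (hl : 0 < l) :
    ∫⁻ y in cube n x l, ENNReal.ofReal (|f y - cubeAvg n f x l| ^ p) ≤
      ENNReal.ofReal (6 * rpowExpConst p / johnNirenbergRate n N ^ p * l ^ n) := by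
  have h := lintegral_rpow_oscillation_le (locallyIntegrable_comp_toLp hf) hN
    (fun x r hr => lintegral_oscillation_le_of_cube hf hN.le hosc x hr) hp (WithLp.ofLp x)
    (half_pos hl)
  rw [lintegral_cube_eq x hl.le, cubeAvg_eq_average f x hl.le]
  simpa [mul_div_cancel₀] using h

end Cubes

/-- John–Nirenberg type `L^p` bound for `BMO_L`: for every `p ∈ [1,∞)` there is a
constant `C` such that for every `f ∈ BMO_L` and every cube `Q`,
`((1/|Q|) ∫_Q |f - f_Q|^p)^{1/p} ≤ C ‖f‖_{BMO_L}`. -/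
theorem bmoL_Lp_oscillation_bound (n : ℕ) (hn : 3 ≤ n) (V : Rn n → ℝ) (q : ℝ)
    (hq : (n : ℝ) / 2 ≤ q) (hV : IsReverseHolder n V q)
    (hV0 : ¬ V =ᵐ[(volume : Measure (Rn n))] 0) :
    ∀ p : ℝ, 1 ≤ p → ∃ C > 0, ∀ f : Rn n → ℝ, LocallyIntegrable f volume →
      ∀ N : ℝ, 0 ≤ N → IsBMOLBound n V f N →
      ∀ (x : Rn n) (l : ℝ), 0 < l →
        IntegrableOn (fun y => |f y - cubeAvg n f x l| ^ p) (cube n x l) volume ∧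
        ((1 / l ^ n) * ∫ y in cube n x l, |f y - cubeAvg n f x l| ^ p) ^ (1 / p) ≤
          C * N := by
  intro p hp
  have hL : 0 < Real.log (3 / 2) := Real.log_pos (by norm_num)
  have hK := rpowExpConst_pos p
  have hp0 : 0 < p := by linarith
  refine ⟨(6 * rpowExpConst p) ^ (1 / p) * ((2 + 2 ^ n) / Real.log (3 / 2)), by positivity, ?_⟩
  intro f hf N hN hB x l hl
  set C := (6 * rpowExpConst p) ^ (1 / p) * ((2 + 2 ^ n) / Real.log (3 / 2)) with hC
  have key : ∀ M, 0 < M → N ≤ M →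
      ∫⁻ y in cube n x l, ENNReal.ofReal (|f y - cubeAvg n f x l| ^ p) ≤
        ENNReal.ofReal ((C * M) ^ p * l ^ n) := by
    intro M hM hNM
    refine (lintegral_cube_rpow_oscillation_le hf hM (fun x' l' hl' => (hB.1 x' l' hl').trans hNM)
      hp0.le x hl).trans_eq ?_
    congr 2
    rw [hC, johnNirenbergRate, mul_assoc, Real.mul_rpow (by positivity) (by positivity),
      ← Real.rpow_mul (by positivity), one_div_mul_cancel hp0.ne', Real.rpow_one, div_eq_mul_inv,
      ← Real.inv_rpow (by positivity), inv_div]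
    congr 2
    ring
  have hmeas : AEStronglyMeasurable (fun y => |f y - cubeAvg n f x l| ^ p)
      (volume.restrict (cube n x l)) :=
    (((hf.aestronglyMeasurable.aemeasurable.sub_const _).norm.pow_const p).mono_measure
      Measure.restrict_le_self).aestronglyMeasurable
  have hnn : ∀ y, 0 ≤ |f y - cubeAvg n f x l| ^ p := fun y => by positivity
  have hN1 : 0 < N + 1 := by linarith
  refine ⟨⟨hmeas, ?_⟩, ?_⟩
  · rw [hasFiniteIntegral_iff_ofReal (Eventually.of_forall hnn)]
    exact (key (N + 1) hN1 (by linarith)).trans_lt ENNReal.ofReal_lt_top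
  · have hCpos : 0 < C := by positivity
    refine le_of_forall_gt_imp_ge_of_dense fun b hb => ?_
    have hb0 : 0 < b := (by positivity : 0 ≤ C * N).trans_lt hb
    have h := key (b / C) (by positivity) (by rw [le_div_iff₀ hCpos]; linarith)
    rw [mul_div_cancel₀ _ hCpos.ne'] at h
    have hint : ∫ y in cube n x l, |f y - cubeAvg n f x l| ^ p ≤ b ^ p * l ^ n := by
      rw [integral_eq_lintegral_of_nonneg_ae (Eventually.of_forall hnn) hmeas]
      exact ENNReal.toReal_le_of_le_ofReal (by positivity) h
    rw [one_div p, Real.rpow_inv_le_iff_of_pos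
      (mul_nonneg (by positivity) (integral_nonneg hnn)) hb0.le hp0, one_div,
      inv_mul_le_iff₀ (by positivity)]
    linarith
end
end

section
/- Let n ≥ 3 and let V ∈ B_q for some q > n/2 be nonnegative. Then there exists a constant C > 0 such that for every x ∈ ℝⁿ and all radii 0 < r < R: (1/r^{n−2}) ∫_{B(x,r)} V(y) dy ≤ C (r/R)^{2−n/q} (1/R^{n−2}) ∫_{B(x,R)} V(y) dy. -/
open MeasureTheory Metric Real

noncomputable section

/-- A nonnegative function with integrable `q`-th power, `q > 0`, belongs to `L^q`. -/
theorem memLp_of_integrable_rpow {α : Type*} [MeasurableSpace α] {μ : Measure α} {f : α → ℝ}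
    {q : ℝ} (hq : 0 < q) (hf : ∀ y, 0 ≤ f y) (hint : Integrable (fun y => f y ^ q) μ) :
    MemLp f (ENNReal.ofReal q) μ := by
  have hmeas : AEStronglyMeasurable f μ := by
    refine (hint.aestronglyMeasurable.aemeasurable.pow_const q⁻¹).aestronglyMeasurable.congr
      (.of_forall fun y => ?_)
    exact Real.rpow_rpow_inv (hf y) hq.ne'
  rw [← integrable_norm_rpow_iff hmeas (by simpa using hq) ENNReal.ofReal_ne_top]
  simpa only [ENNReal.toReal_ofReal hq.le, Real.norm_of_nonneg (hf _)] using hint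

/-- Hölder's inequality against the constant function `1`. -/
theorem integral_le_measureReal_rpow_mul_integral_rpow {α : Type*} [MeasurableSpace α]
    {μ : Measure α} [IsFiniteMeasure μ] {f : α → ℝ} {q : ℝ} (hq : 1 < q) (hf : ∀ y, 0 ≤ f y)
    (hint : Integrable (fun y => f y ^ q) μ) :
    ∫ y, f y ∂μ ≤ μ.real Set.univ ^ (1 - 1 / q) * (∫ y, f y ^ q ∂μ) ^ (1 / q) := by
  have hpq := (Real.HolderConjugate.conjExponent hq).symm
  have h := integral_mul_le_Lp_mul_Lq_of_nonneg hpq (μ := μ) (f := fun _ => (1 : ℝ)) (g := f)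
    (.of_forall fun _ => zero_le_one) (.of_forall hf) (memLp_const 1)
    (memLp_of_integrable_rpow (by linarith) hf hint)
  have he : 1 / Real.conjExponent q = 1 - 1 / q := by
    have := hpq.inv_add_inv_eq_one
    simp only [one_div]
    linarith
  simpa [he] using h

/-- Doubling-type estimate for `V ∈ B_q`, `q > n/2`: for all `0 < r < R`,
`(1/r^{n-2}) ∫_{B(x,r)} V ≤ C (r/R)^{2-n/q} (1/R^{n-2}) ∫_{B(x,R)} V`. -/
theorem reverse_holder_scaling (n : ℕ) (hn : 3 ≤ n) (V : Rn n → ℝ) (q : ℝ)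
    (hq : (n : ℝ) / 2 < q) (hV : IsReverseHolder n V q) :
    ∃ C > 0, ∀ (x : Rn n) (r R : ℝ), 0 < r → r < R →
      r ^ ((2 : ℝ) - n) * (∫ y in ball x r, V y) ≤
        C * (r / R) ^ ((2 : ℝ) - n / q) *
          (R ^ ((2 : ℝ) - n) * ∫ y in ball x R, V y) := by
  obtain ⟨hnn, hint, C, hC, hRH⟩ := hV
  have hn' : (3 : ℝ) ≤ n := by exact_mod_cast hn
  have hq1 : 1 < q := by linarith
  have hq0 : 0 < q := by linarith
  refine ⟨C, hC, fun x r R hr hrR => ?_⟩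
  have hR : 0 < R := hr.trans hrR
  set b : ℝ := volume.real (ball (0 : Rn n) 1)
  have hb : 0 < b := ENNReal.toReal_pos (measure_ball_pos _ _ one_pos).ne' measure_ball_lt_top.ne
  have hvol : ∀ s : ℝ, 0 < s → volume.real (ball x s) = s ^ (n : ℝ) * b := fun s hs => by
    rw [measureReal_def, Measure.addHaar_ball_of_pos _ x hs, ENNReal.toReal_mul,
      ENNReal.toReal_ofReal (by positivity), finrank_euclideanSpace_fin, Real.rpow_natCast]
    rfl
  have hI0 : 0 ≤ ∫ y in ball x R, V y ^ q :=
    integral_nonneg fun y => Real.rpow_nonneg (hnn y) q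
  have hIr0 : 0 ≤ ∫ y in ball x r, V y ^ q :=
    integral_nonneg fun y => Real.rpow_nonneg (hnn y) q
  have hmono : ∫ y in ball x r, V y ^ q ≤ ∫ y in ball x R, V y ^ q :=
    setIntegral_mono_set (hint x R hR) (.of_forall fun y => Real.rpow_nonneg (hnn y) q)
      (ball_subset_ball hrR.le).eventuallyLE
  have : IsFiniteMeasure (volume.restrict (ball x r)) := ⟨by simp [measure_ball_lt_top]⟩
  have hH := integral_le_measureReal_rpow_mul_integral_rpow hq1 hnn (hint x r hr)
  rw [measureReal_restrict_apply_univ, hvol r hr] at hH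
  have hrev := hRH x R hR
  rw [← measureReal_def, hvol R hR] at hrev
  have hvR : 0 < R ^ (n : ℝ) * b := by positivity
  set J : ℝ := ∫ y in ball x R, V y
  have hroot : (∫ y in ball x R, V y ^ q) ^ (1 / q) ≤
      (R ^ (n : ℝ) * b) ^ (1 / q) * (C * (R ^ (n : ℝ) * b)⁻¹ * J) := by
    rw [Real.mul_rpow (by positivity) hI0, Real.inv_rpow hvR.le, inv_mul_le_iff₀ (by positivity)]
      at hrev
    exact hrev
  have hpow : r ^ ((2 : ℝ) - n) * ((r ^ (n : ℝ) * b) ^ (1 - 1 / q) *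
      ((R ^ (n : ℝ) * b) ^ (1 / q) * (R ^ (n : ℝ) * b)⁻¹)) =
      (r / R) ^ ((2 : ℝ) - n / q) * R ^ ((2 : ℝ) - n) := by
    rw [← Real.rpow_neg_one (R ^ (n : ℝ) * b), ← Real.rpow_add hvR,
      Real.div_rpow hr.le hR.le, Real.mul_rpow (by positivity) hb.le,
      Real.mul_rpow (by positivity) hb.le, ← Real.rpow_mul hr.le, ← Real.rpow_mul hR.le,
      div_eq_mul_inv (r ^ _), ← Real.rpow_neg hR.le]
    have hr' : r ^ ((2 : ℝ) - n) * r ^ ((n : ℝ) * (1 - 1 / q)) = r ^ ((2 : ℝ) - n / q) := by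
      rw [← Real.rpow_add hr]; congr 1; ring
    have hR' : R ^ ((n : ℝ) * (1 / q + -1)) = R ^ (-((2 : ℝ) - n / q)) * R ^ ((2 : ℝ) - n) := by
      rw [← Real.rpow_add hR]; congr 1; ring
    have hb' : b ^ (1 - 1 / q) * b ^ (1 / q + -1) = 1 := by
      rw [← Real.rpow_add hb, ← Real.rpow_zero b]; congr 1; ring
    rw [← hr', hR']
    linear_combination (r ^ ((2 : ℝ) - n) * r ^ ((n : ℝ) * (1 - 1 / q)) *
      (R ^ (-((2 : ℝ) - n / q)) * R ^ ((2 : ℝ) - n))) * hb'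
  calc r ^ ((2 : ℝ) - n) * (∫ y in ball x r, V y)
      ≤ r ^ ((2 : ℝ) - n) * ((r ^ (n : ℝ) * b) ^ (1 - 1 / q) *
          ((R ^ (n : ℝ) * b) ^ (1 / q) * (C * (R ^ (n : ℝ) * b)⁻¹ * J))) := by
        gcongr
        refine hH.trans ?_
        gcongr
        exact (Real.rpow_le_rpow hIr0 hmono (by positivity)).trans hroot
    _ = C * (r / R) ^ ((2 : ℝ) - n / q) * (R ^ ((2 : ℝ) - n) * J) := by
        linear_combination C * J * hpow
end
end
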